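/- arXiv:2011.14374 — 2 statements merged into one kernel-verified Lean document; each statement's English description precedes it below -/
import Mathlib

section
/- Let σ be a Borel measure on ℝ satisfying ∫_ℝ dσ(x)/(1+x²) < ∞. Let Φ(x) = |(e^{ix} − 1)/(ix)|² = (2 − 2cos x)/x² (the continuous Fejér kernel) and Φ_r(x) = r Φ(r x) for r > 0. Then for Lebesgue-almost every z ∈ ℝ one has ∫_ℝ Φ_r(z − x) dσ(x) → 2π σ′(z) as r → ∞, where σ′ is the Radon–Nikodym derivative of the absolutely continuous part of σ with respect to Lebesgue measure. -/
open MeasureTheory Filter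

noncomputable section

/-- `σ′`: the density of the absolutely continuous part of `σ` w.r.t. Lebesgue measure. -/
def szegoDeriv (σ : Measure ℝ) (x : ℝ) : ℝ := (σ.rnDeriv volume x).toReal

/-- The continuous Fejér kernel `Φ(x) = |(e^{ix}-1)/(ix)|² = (2-2cos x)/x²` (with
`Φ(0) = 1`). -/
def fejerKernel (x : ℝ) : ℝ := if x = 0 then 1 else (2 - 2 * Real.cos x) / x ^ 2

lemma fejerKernel_nonneg (x : ℝ) : 0 ≤ fejerKernel x := by
  unfold fejerKernel
  split_ifs
  · exact zero_le_one
  · have := Real.cos_le_one x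
    exact div_nonneg (by linarith) (sq_nonneg x)

lemma fejerKernel_le_one (x : ℝ) : fejerKernel x ≤ 1 := by
  unfold fejerKernel
  split_ifs
  · exact le_rfl
  · have := Real.one_sub_sq_div_two_le_cos (x := x)
    exact div_le_one_of_le₀ (by linarith) (sq_nonneg x)

lemma fejerKernel_mul_sq_le (x : ℝ) : fejerKernel x * x ^ 2 ≤ 4 := by
  unfold fejerKernel
  split_ifs with h
  · simp [h]
  · have := Real.neg_one_le_cos x
    rw [div_mul_cancel₀ _ (pow_ne_zero 2 h)]
    linarith

@[fun_prop]
lemma measurable_fejerKernel : Measurable fejerKernel :=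
  Measurable.ite (measurableSet_singleton 0) measurable_const (by fun_prop)

lemma integrable_fejerKernel : Integrable fejerKernel := by
  refine (integrable_inv_one_add_sq.const_mul 5).mono'
    measurable_fejerKernel.aestronglyMeasurable (ae_of_all _ fun x => ?_)
  rw [Real.norm_of_nonneg (fejerKernel_nonneg x), ← div_eq_mul_inv, le_div_iff₀ (by positivity)]
  linarith [fejerKernel_le_one x, fejerKernel_mul_sq_le x]

lemma integral_one_sub_mul_cexp {a : ℂ} (ha : a ≠ 0) :
    ∫ x in (0 : ℝ)..1, (1 - (x : ℂ)) * Complex.exp (a * x) =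
      Complex.exp a / a ^ 2 - 1 / a - 1 / a ^ 2 := by
  have hderiv (x : ℝ) : HasDerivAt
      (fun y : ℝ => (1 - (y : ℂ)) * Complex.exp (a * y) / a + Complex.exp (a * y) / a ^ 2)
      ((1 - (x : ℂ)) * Complex.exp (a * x)) x := by
    have h₁ : HasDerivAt (fun y : ℝ => (y : ℂ)) 1 x := Complex.ofRealCLM.hasDerivAt
    have h₂ := (h₁.const_mul a).cexp
    refine ((((h₁.const_sub 1).mul h₂).div_const a).add (h₂.div_const (a ^ 2))).congr_deriv ?_
    field_simp
    ring
  rw [intervalIntegral.integral_eq_sub_of_hasDerivAt (fun x _ => hderiv x)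
    (Continuous.intervalIntegrable (by fun_prop) _ _)]
  simp
  ring

/-- The triangle function `max (1 - |x|) 0`. -/
def triangle (x : ℝ) : ℂ := (max (1 - |x|) 0 : ℝ)

lemma continuous_triangle : Continuous triangle := by
  unfold triangle
  fun_prop

lemma triangle_eq_zero {x : ℝ} (hx : x ∉ Set.Ioc (-1 : ℝ) 1) : triangle x = 0 := by
  have : 1 - |x| ≤ 0 := by
    rw [Set.mem_Ioc, not_and_or, not_lt, not_le] at hx
    rcases hx with hx | hx
    · linarith [neg_le_abs x]
    · linarith [le_abs_self x]
  simp [triangle, max_eq_right this]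

lemma integrable_triangle : Integrable triangle := by
  refine continuous_triangle.integrable_of_hasCompactSupport
    (HasCompactSupport.intro (isCompact_Icc (a := (-1 : ℝ)) (b := 1)) fun x hx => ?_)
  exact triangle_eq_zero fun h => hx (Set.Ioc_subset_Icc_self h)

open scoped FourierTransform in
lemma fourier_triangle {w : ℝ} (hw : w ≠ 0) :
    𝓕 triangle w = (fejerKernel (2 * Real.pi * w) : ℂ) := by
  set c : ℝ := 2 * Real.pi * w with hc
  have hc0 : c ≠ 0 := by positivity
  have hcC : (c : ℂ) * Complex.I ≠ 0 := by simp [hc0]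
  have hexp (v : ℝ) : Complex.exp (↑(-2 * Real.pi * v * w) * Complex.I) • triangle v =
      triangle v * Complex.exp (-(c * Complex.I) * v) := by
    rw [smul_eq_mul, mul_comm, hc]
    push_cast
    ring_nf
  rw [Real.fourier_real_eq_integral_exp_smul]
  simp_rw [hexp]
  rw [← setIntegral_eq_integral_of_forall_compl_eq_zero (s := Set.Ioc (-1 : ℝ) 1)
      (fun x hx => by rw [triangle_eq_zero hx, zero_mul]),
    ← intervalIntegral.integral_of_le (by norm_num)]
  have hint (a b : ℝ) : IntervalIntegrable
      (fun v : ℝ => triangle v * Complex.exp (-(c * Complex.I) * v)) volume a b :=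
    (continuous_triangle.mul (by fun_prop)).intervalIntegrable a b
  have hright (b : ℂ) : ∫ v in (0 : ℝ)..1, triangle v * Complex.exp (b * v) =
      ∫ v in (0 : ℝ)..1, (1 - (v : ℂ)) * Complex.exp (b * v) := by
    refine intervalIntegral.integral_congr fun v hv => ?_
    rw [Set.uIcc_of_le zero_le_one] at hv
    simp [triangle, abs_of_nonneg hv.1, hv.2]
  have hleft : ∫ v in (-1 : ℝ)..0, triangle v * Complex.exp (-(c * Complex.I) * v) =
      ∫ v in (0 : ℝ)..1, triangle v * Complex.exp ((c * Complex.I) * v) := by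
    have := intervalIntegral.integral_comp_neg (a := 0) (b := 1)
      (fun v : ℝ => triangle v * Complex.exp (-(c * Complex.I) * v))
    rw [neg_zero] at this
    rw [← this]
    simp [triangle]
  rw [← intervalIntegral.integral_add_adjacent_intervals (hint (-1) 0) (hint 0 1), hleft,
    hright, hright, integral_one_sub_mul_cexp hcC, integral_one_sub_mul_cexp (neg_ne_zero.2 hcC)]
  have hcos : Complex.exp (c * Complex.I) + Complex.exp (-(c * Complex.I)) =
      2 * Complex.cos c := by
    rw [Complex.cos, neg_mul]
    ring
  have hcC' : (c : ℂ) ≠ 0 := by exact_mod_cast hc0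
  rw [fejerKernel, if_neg hc0]
  push_cast
  rw [show 2 - 2 * Complex.cos c = 2 - (Complex.exp (c * Complex.I) +
    Complex.exp (-(c * Complex.I))) by rw [hcos]]
  simp only [neg_sq, mul_pow, Complex.I_sq]
  field_simp
  ring

open scoped FourierTransform in
lemma integral_fejerKernel : ∫ x, fejerKernel x = 2 * Real.pi := by
  have hae : 𝓕 triangle =ᵐ[volume] fun w => (fejerKernel (2 * Real.pi * w) : ℂ) := by
    filter_upwards [Measure.ae_ne volume (0 : ℝ)] with w hw using fourier_triangle hw
  have hint : Integrable (𝓕 triangle) := by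
    refine Integrable.congr ?_ hae.symm
    exact (integrable_fejerKernel.comp_mul_left' (by positivity)).ofReal
  have hinv := congrFun (continuous_triangle.fourierInv_fourier_eq integrable_triangle hint) 0
  rw [Real.fourierInv_eq'] at hinv
  have h1 : ∫ w, (fejerKernel (2 * Real.pi * w) : ℂ) = 1 := by
    rw [← integral_congr_ae hae]
    simpa [triangle] using hinv
  rw [integral_complex_ofReal, Measure.integral_comp_mul_left] at h1
  have h2 : |(2 * Real.pi)⁻¹| • ∫ y, fejerKernel y = 1 := by exact_mod_cast h1
  rw [abs_of_pos (by positivity), smul_eq_mul, inv_mul_eq_one₀ (by positivity)] at h2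
  exact h2.symm

lemma fejerKernel_le_sixteen_div_four_pow (u : ℝ) :
    ∃ k : ℕ, |u| ≤ 2 ^ k ∧ fejerKernel u ≤ 16 * (1 / 4) ^ k := by
  have hex : ∃ k : ℕ, |u| ≤ 2 ^ k :=
    (pow_unbounded_of_one_lt |u| one_lt_two).imp fun _ h => h.le
  classical
  refine ⟨Nat.find hex, Nat.find_spec hex, ?_⟩
  rcases hk : Nat.find hex with _ | m
  · linarith [fejerKernel_le_one u, pow_zero (1 / 4 : ℝ)]
  · have hm : 2 ^ m < |u| := not_le.1 (Nat.find_min hex (by omega))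
    have hsq : (4 : ℝ) ^ m ≤ u ^ 2 := by
      rw [← sq_abs u, show (4 : ℝ) = 2 ^ 2 by norm_num, ← pow_mul, mul_comm, pow_mul]
      gcongr
    have h4 : fejerKernel u * 4 ^ m ≤ 4 :=
      (mul_le_mul_of_nonneg_left hsq (fejerKernel_nonneg u)).trans (fejerKernel_mul_sq_le u)
    rw [pow_succ, one_div_pow]
    have : (0 : ℝ) < 4 ^ m := by positivity
    field_simp
    linarith

open scoped ENNReal

lemma ofReal_fejerKernel_le_tsum {r : ℝ} (hr : 0 < r) (z x : ℝ) :
    ENNReal.ofReal (fejerKernel (r * (z - x))) ≤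
      ∑' k : ℕ, (Metric.closedBall z (2 ^ k / r)).indicator
        (fun _ => ENNReal.ofReal (16 * (1 / 4) ^ k)) x := by
  obtain ⟨k, hk, hle⟩ := fejerKernel_le_sixteen_div_four_pow (r * (z - x))
  refine le_trans ?_ (ENNReal.le_tsum k)
  rw [Set.indicator_of_mem]
  · exact ENNReal.ofReal_le_ofReal hle
  · rw [Metric.mem_closedBall, dist_comm, Real.dist_eq, le_div_iff₀ hr, mul_comm]
    rwa [abs_mul, abs_of_pos hr] at hk

lemma setLIntegral_fejerKernel_closedBall_le {ν : Measure ℝ} {z δ r : ℝ} {ε : ℝ≥0∞}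
    (hδ : 0 < δ) (hr : 0 < r)
    (hν : ∀ s, 0 < s → s ≤ δ → ν (Metric.closedBall z s) ≤ ε * ENNReal.ofReal s) :
    ∫⁻ x in Metric.closedBall z δ, ENNReal.ofReal (r * fejerKernel (r * (z - x))) ∂ν ≤
      32 * ε := by
  have hball (s : ℝ) (hs : 0 < s) :
      ν.restrict (Metric.closedBall z δ) (Metric.closedBall z s) ≤ ε * ENNReal.ofReal s := by
    rw [Measure.restrict_apply Metric.isClosed_closedBall.measurableSet]
    rcases le_total s δ with h | h
    · exact (measure_mono Set.inter_subset_left).trans (hν s hs h)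
    · calc _ ≤ ν (Metric.closedBall z δ) := measure_mono Set.inter_subset_right
        _ ≤ ε * ENNReal.ofReal δ := hν δ hδ le_rfl
        _ ≤ ε * ENNReal.ofReal s := by gcongr
  calc ∫⁻ x in Metric.closedBall z δ, ENNReal.ofReal (r * fejerKernel (r * (z - x))) ∂ν
      ≤ ∫⁻ x in Metric.closedBall z δ, ENNReal.ofReal r *
          ∑' k : ℕ, (Metric.closedBall z (2 ^ k / r)).indicator
            (fun _ => ENNReal.ofReal (16 * (1 / 4) ^ k)) x ∂ν := by
        refine lintegral_mono fun x => ?_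
        rw [ENNReal.ofReal_mul hr.le]
        gcongr
        exact ofReal_fejerKernel_le_tsum hr z x
    _ = ENNReal.ofReal r * ∑' k : ℕ, ENNReal.ofReal (16 * (1 / 4) ^ k) *
          ν.restrict (Metric.closedBall z δ) (Metric.closedBall z (2 ^ k / r)) := by
        have hm (k : ℕ) : Measurable ((Metric.closedBall z (2 ^ k / r)).indicator
            (fun _ => ENNReal.ofReal (16 * (1 / 4) ^ k))) :=
          measurable_const.indicator Metric.isClosed_closedBall.measurableSet
        rw [lintegral_const_mul _ (Measurable.tsum hm),
          lintegral_tsum fun k => (hm k).aemeasurable]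
        simp_rw [lintegral_indicator_const Metric.isClosed_closedBall.measurableSet]
    _ ≤ ENNReal.ofReal r * ∑' k : ℕ, ENNReal.ofReal (16 * (1 / 4) ^ k) *
          (ε * ENNReal.ofReal (2 ^ k / r)) := by
        gcongr with k
        exact hball _ (by positivity)
    _ = ∑' k : ℕ, 16 * ε * 2⁻¹ ^ k := by
        rw [← ENNReal.tsum_mul_left]
        refine tsum_congr fun k => ?_
        have h : r * (16 * (1 / 4) ^ k) * (2 ^ k / r) = 16 * (2⁻¹) ^ k := by
          have h2 : (2⁻¹ : ℝ) ^ k * 2 ^ k = 1 := by rw [← mul_pow]; norm_num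
          rw [show (1 / 4 : ℝ) = 2⁻¹ * 2⁻¹ by norm_num, mul_pow]
          calc _ = 16 * 2⁻¹ ^ k * (2⁻¹ ^ k * 2 ^ k) * (r / r) := by ring
            _ = _ := by rw [h2, div_self hr.ne', mul_one, mul_one]
        calc _ = ε * ENNReal.ofReal (r * (16 * (1 / 4) ^ k) * (2 ^ k / r)) := by
              rw [ENNReal.ofReal_mul (p := r * _) (by positivity), ENNReal.ofReal_mul hr.le]
              ring
          _ = _ := by
              rw [h, ENNReal.ofReal_mul (by norm_num), ENNReal.ofReal_pow (by norm_num),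
                ENNReal.ofReal_inv_of_pos two_pos, ENNReal.ofReal_ofNat, ENNReal.ofReal_ofNat]
              ring
    _ = 32 * ε := by
        rw [ENNReal.tsum_mul_left, ENNReal.tsum_geometric, ENNReal.one_sub_inv_two, inv_inv]
        ring

lemma setLIntegral_fejerKernel_compl_closedBall_le (ν : Measure ℝ) {z δ r : ℝ}
    (hδ : 0 < δ) (hr : 0 < r) :
    ∫⁻ x in (Metric.closedBall z δ)ᶜ, ENNReal.ofReal (r * fejerKernel (r * (z - x))) ∂ν ≤
      ENNReal.ofReal (4 * ((1 + 2 * z ^ 2) / δ ^ 2 + 2) / r) *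
        ∫⁻ x, ENNReal.ofReal (1 / (1 + x ^ 2)) ∂ν := by
  rw [← lintegral_const_mul _ (by fun_prop)]
  refine (setLIntegral_mono (by fun_prop) fun x hx => ?_).trans
    (setLIntegral_le_lintegral _ _)
  rw [← ENNReal.ofReal_mul (by positivity)]
  refine ENNReal.ofReal_le_ofReal ?_
  have hx' : δ < |z - x| := by
    rwa [Set.mem_compl_iff, Metric.mem_closedBall, not_le, dist_comm, Real.dist_eq] at hx
  have hδx : δ ^ 2 ≤ (z - x) ^ 2 := by
    rw [← sq_abs (z - x)]
    gcongr
  have hpos : 0 < (z - x) ^ 2 := lt_of_lt_of_le (by positivity) hδx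
  have hC : 1 + x ^ 2 ≤ ((1 + 2 * z ^ 2) / δ ^ 2 + 2) * (z - x) ^ 2 := by
    have : 1 + 2 * z ^ 2 ≤ (1 + 2 * z ^ 2) / δ ^ 2 * (z - x) ^ 2 := by
      rw [div_mul_eq_mul_div, le_div_iff₀ (by positivity)]
      gcongr
    nlinarith [sq_nonneg (2 * z - x)]
  have hk := fejerKernel_mul_sq_le (r * (z - x))
  calc r * fejerKernel (r * (z - x))
      = fejerKernel (r * (z - x)) * (r * (z - x)) ^ 2 / (r * (z - x) ^ 2) := by
        rw [eq_div_iff (by positivity)]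
        ring
    _ ≤ 4 / (r * (z - x) ^ 2) := by gcongr
    _ ≤ 4 * ((1 + 2 * z ^ 2) / δ ^ 2 + 2) / r * (1 / (1 + x ^ 2)) := by
        rw [div_mul_div_comm, mul_one, div_le_div_iff₀ (by positivity) (by positivity)]
        nlinarith [mul_le_mul_of_nonneg_left hC (by positivity : 0 ≤ 4 * r)]

/-- If `ν` has vanishing upper density at `z` and integrates `1 / (1 + x ^ 2)`, then the rescaled
Fejér means of `ν` at `z` tend to zero. -/
lemma tendsto_lintegral_fejerKernel_zero {ν : Measure ℝ} {z : ℝ}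
    (hfin : ∫⁻ x, ENNReal.ofReal (1 / (1 + x ^ 2)) ∂ν ≠ ∞)
    (hν : Tendsto (fun s => ν (Metric.closedBall z s) / volume (Metric.closedBall z s))
      (nhdsWithin 0 (Set.Ioi 0)) (nhds 0)) :
    Tendsto (fun r : ℝ => ∫⁻ x, ENNReal.ofReal (r * fejerKernel (r * (z - x))) ∂ν)
      atTop (nhds 0) := by
  refine ENNReal.tendsto_nhds_zero.2 fun ε hε => ?_
  set η : ℝ≥0∞ := ε / 128 with hη
  have hη0 : 0 < η := ENNReal.div_pos hε.ne' (by simp)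
  obtain ⟨δ, hδ, hball⟩ := mem_nhdsGT_iff_exists_Ioc_subset.1
    (ENNReal.tendsto_nhds_zero.1 hν η hη0)
  have hδ : 0 < δ := hδ
  have hnear (s : ℝ) (hs : 0 < s) (hsδ : s ≤ δ) :
      ν (Metric.closedBall z s) ≤ 2 * η * ENNReal.ofReal s := by
    have h : ν (Metric.closedBall z s) / volume (Metric.closedBall z s) ≤ η := hball ⟨hs, hsδ⟩
    rw [Real.volume_closedBall, ENNReal.div_le_iff (by simpa using hs) ENNReal.ofReal_ne_top,
      ENNReal.ofReal_mul zero_le_two, ENNReal.ofReal_ofNat] at h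
    exact h.trans_eq (by ring)
  have hfar : Tendsto (fun r : ℝ => ENNReal.ofReal (4 * ((1 + 2 * z ^ 2) / δ ^ 2 + 2) / r) *
      ∫⁻ x, ENNReal.ofReal (1 / (1 + x ^ 2)) ∂ν) atTop (nhds 0) := by
    have := ENNReal.Tendsto.mul_const (b := ∫⁻ x, ENNReal.ofReal (1 / (1 + x ^ 2)) ∂ν)
      (ENNReal.tendsto_ofReal (tendsto_const_nhds.div_atTop tendsto_id :
        Tendsto (fun r : ℝ => 4 * ((1 + 2 * z ^ 2) / δ ^ 2 + 2) / r) atTop (nhds 0)))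
      (Or.inr hfin)
    simpa using this
  have hε2 : 0 < ε / 2 := ENNReal.half_pos hε.ne'
  filter_upwards [ENNReal.tendsto_nhds_zero.1 hfar (ε / 2) hε2, eventually_gt_atTop 0]
    with r hr hr0
  rw [← lintegral_add_compl _ (Metric.isClosed_closedBall (x := z) (ε := δ)).measurableSet,
    ← ENNReal.add_halves ε]
  refine add_le_add ?_ ((setLIntegral_fejerKernel_compl_closedBall_le ν hδ hr0).trans hr)
  refine (setLIntegral_fejerKernel_closedBall_le hδ hr0 hnear).trans_eq ?_
  rw [hη, show (128 : ℝ≥0∞) = 64 * 2 by norm_num, div_eq_mul_inv, div_eq_mul_inv,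
    ENNReal.mul_inv (by simp) (by simp)]
  rw [show (32 : ℝ≥0∞) * (2 * (ε * (64⁻¹ * 2⁻¹))) = (64 * 64⁻¹) * (ε * 2⁻¹) by ring,
    ENNReal.mul_inv_cancel (by simp) (by simp), one_mul]

lemma isLocallyFiniteMeasure_of_integrable_one_div_one_add_sq {σ : Measure ℝ}
    (hσ : Integrable (fun x : ℝ => 1 / (1 + x ^ 2)) σ) : IsLocallyFiniteMeasure σ := by
  refine ⟨fun x => ⟨Metric.ball x 1, Metric.ball_mem_nhds x one_pos, ?_⟩⟩
  have hc : 0 < 1 / (1 + (|x| + 1) ^ 2) := by positivity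
  refine (measure_mono fun y hy => ?_).trans_lt (hσ.measure_ge_lt_top hc)
  rw [Metric.mem_ball, Real.dist_eq] at hy
  have hy' : |y| ≤ |x| + 1 := by
    have := abs_sub_abs_le_abs_sub y x
    linarith
  have hsq : y ^ 2 ≤ (|x| + 1) ^ 2 := by
    rw [← sq_abs y]
    gcongr
  have hpos : 0 < 1 + y ^ 2 := by positivity
  exact one_div_le_one_div_of_le hpos (by linarith)

lemma integrable_fejerKernel_comp {σ : Measure ℝ}
    (hσ : Integrable (fun x : ℝ => 1 / (1 + x ^ 2)) σ) {r : ℝ} (hr : 0 < r) (z : ℝ) :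
    Integrable (fun x => r * fejerKernel (r * (z - x))) σ := by
  have := isLocallyFiniteMeasure_of_integrable_one_div_one_add_sq hσ
  refine ⟨Measurable.aestronglyMeasurable (by fun_prop), ?_⟩
  rw [hasFiniteIntegral_iff_ofReal
    (ae_of_all _ fun x => mul_nonneg hr.le (fejerKernel_nonneg _)),
    ← lintegral_add_compl _ (Metric.isClosed_closedBall (x := z) (ε := 1)).measurableSet]
  refine ENNReal.add_lt_top.2 ⟨?_, ?_⟩
  · refine setLIntegral_lt_top_of_le_nnreal ?_ ⟨r.toNNReal, fun x _ => ?_⟩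
    · exact (isCompact_closedBall z 1).measure_lt_top.ne
    · refine ENNReal.ofReal_le_ofReal ?_
      exact mul_le_of_le_one_right hr.le (fejerKernel_le_one _)
  · exact (setLIntegral_fejerKernel_compl_closedBall_le σ one_pos hr).trans_lt
      (ENNReal.mul_lt_top ENNReal.ofReal_lt_top hσ.lintegral_lt_top)

lemma integral_fejerKernel_comp {r : ℝ} (hr : 0 < r) (z : ℝ) :
    ∫ x, r * fejerKernel (r * (z - x)) = 2 * Real.pi := by
  rw [integral_const_mul, integral_sub_left_eq_self (fun x => fejerKernel (r * x)) volume z,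
    Measure.integral_comp_mul_left, integral_fejerKernel, abs_of_pos (inv_pos.2 hr), smul_eq_mul,
    mul_inv_cancel_left₀ hr.ne']

lemma locallyIntegrable_szegoDeriv (σ : Measure ℝ) [IsLocallyFiniteMeasure σ] :
    LocallyIntegrable (szegoDeriv σ) volume := by
  intro x
  obtain ⟨s, hs, hfin⟩ := σ.finiteAt_nhds x
  refine ⟨s, hs, integrable_toReal_of_lintegral_ne_top
    (Measure.measurable_rnDeriv σ volume).aemeasurable ?_⟩
  exact ((Measure.setLIntegral_rnDeriv_le s).trans_lt hfin).ne

/-- The measure `|f(x) - f(z)| dx + dσₛ(x)`, where `f` is the density of the absolutely continuous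
part of `σ` and `σₛ` its singular part. -/
def deviationMeasure (σ : Measure ℝ) (z : ℝ) : Measure ℝ :=
  volume.withDensity (fun x => ‖szegoDeriv σ x - szegoDeriv σ z‖ₑ) + σ.singularPart volume

@[fun_prop]
lemma measurable_szegoDeriv (σ : Measure ℝ) : Measurable (szegoDeriv σ) :=
  (Measure.measurable_rnDeriv σ volume).ennreal_toReal

lemma ae_tendsto_deviationMeasure_div (σ : Measure ℝ) [IsLocallyFiniteMeasure σ] :
    ∀ᵐ z : ℝ, Tendsto (fun s => deviationMeasure σ z (Metric.closedBall z s) /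
      volume (Metric.closedBall z s)) (nhdsWithin 0 (Set.Ioi 0)) (nhds 0) := by
  filter_upwards [(Besicovitch.vitaliFamily volume).ae_tendsto_lintegral_enorm_sub_div
      (locallyIntegrable_szegoDeriv σ), Besicovitch.ae_tendsto_rnDeriv (σ.singularPart volume)
      volume, Measure.rnDeriv_singularPart σ volume] with z hac hs hs0
  rw [hs0, Pi.zero_apply] at hs
  have := (hac.comp (Besicovitch.tendsto_filterAt volume z)).add hs
  rw [zero_add] at this
  refine this.congr fun s => ?_
  rw [Function.comp_apply, deviationMeasure, Measure.add_apply,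
    withDensity_apply _ Metric.isClosed_closedBall.measurableSet, ENNReal.add_div]

lemma withDensity_enorm_szegoDeriv_le (σ : Measure ℝ) :
    volume.withDensity (fun x => ‖szegoDeriv σ x‖ₑ) ≤ σ := by
  refine (withDensity_mono (ae_of_all _ fun x => ?_)).trans
    (Measure.withDensity_rnDeriv_le σ volume)
  rw [szegoDeriv, Real.enorm_of_nonneg ENNReal.toReal_nonneg]
  exact ENNReal.ofReal_toReal_le

lemma lintegral_deviationMeasure_ne_top {σ : Measure ℝ}
    (hσ : Integrable (fun x : ℝ => 1 / (1 + x ^ 2)) σ) (z : ℝ) :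
    ∫⁻ x, ENNReal.ofReal (1 / (1 + x ^ 2)) ∂(deviationMeasure σ z) ≠ ∞ := by
  have hvol : Integrable (fun x : ℝ => 1 / (1 + x ^ 2)) := by
    simpa [one_div] using integrable_inv_one_add_sq
  have hle : deviationMeasure σ z ≤ σ + ‖szegoDeriv σ z‖ₑ • volume + σ := by
    refine add_le_add ?_ (Measure.singularPart_le σ volume)
    calc _ ≤ volume.withDensity ((fun x => ‖szegoDeriv σ x‖ₑ) + fun _ => ‖szegoDeriv σ z‖ₑ) :=
          withDensity_mono (ae_of_all _ fun x => enorm_sub_le)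
      _ = volume.withDensity (fun x => ‖szegoDeriv σ x‖ₑ) + ‖szegoDeriv σ z‖ₑ • volume := by
          rw [withDensity_add_right _ measurable_const, withDensity_const]
      _ ≤ _ := add_le_add (withDensity_enorm_szegoDeriv_le σ) le_rfl
  refine ((lintegral_mono' hle le_rfl).trans_lt ?_).ne
  rw [lintegral_add_measure, lintegral_add_measure, lintegral_smul_measure]
  exact ENNReal.add_lt_top.2 ⟨ENNReal.add_lt_top.2 ⟨hσ.lintegral_lt_top,
    ENNReal.mul_lt_top enorm_lt_top hvol.lintegral_lt_top⟩, hσ.lintegral_lt_top⟩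

lemma edist_integral_fejerKernel_le {σ : Measure ℝ}
    (hσ : Integrable (fun x : ℝ => 1 / (1 + x ^ 2)) σ) {r : ℝ} (hr : 0 < r) (z : ℝ) :
    edist (∫ x, r * fejerKernel (r * (z - x)) ∂σ) (2 * Real.pi * szegoDeriv σ z) ≤
      ∫⁻ x, ENNReal.ofReal (r * fejerKernel (r * (z - x))) ∂(deviationMeasure σ z) := by
  have := isLocallyFiniteMeasure_of_integrable_one_div_one_add_sq hσ
  have hvol : Integrable (fun x : ℝ => 1 / (1 + x ^ 2)) := by
    simpa [one_div] using integrable_inv_one_add_sq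
  set K : ℝ → ℝ := fun x => r * fejerKernel (r * (z - x))
  have hK0 (x : ℝ) : 0 ≤ K x := mul_nonneg hr.le (fejerKernel_nonneg _)
  have hKm : Measurable K := by fun_prop
  have hKσ : Integrable K σ := integrable_fejerKernel_comp hσ hr z
  have hKvol : Integrable K := integrable_fejerKernel_comp hvol hr z
  have hlt := Measure.rnDeriv_lt_top σ volume
  have hKac : Integrable (fun x => szegoDeriv σ x * K x) :=
    (integrable_withDensity_iff_integrable_smul' (Measure.measurable_rnDeriv σ volume) hlt).1
      (hKσ.mono_measure (Measure.withDensity_rnDeriv_le σ volume))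
  have hsplit : ∫ x, K x ∂σ =
      ∫ x, K x ∂(σ.singularPart volume) + ∫ x, szegoDeriv σ x * K x := by
    conv_lhs => rw [← Measure.singularPart_add_rnDeriv σ volume]
    rw [integral_add_measure (hKσ.mono_measure (Measure.singularPart_le σ volume))
      (hKσ.mono_measure (Measure.withDensity_rnDeriv_le σ volume)),
      integral_withDensity_eq_integral_toReal_smul (Measure.measurable_rnDeriv σ volume) hlt]
    rfl
  have hdiff : ∫ x, K x ∂σ - 2 * Real.pi * szegoDeriv σ z =
      (∫ x, (szegoDeriv σ x - szegoDeriv σ z) * K x) + ∫ x, K x ∂(σ.singularPart volume) := by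
    simp_rw [sub_mul]
    rw [integral_sub hKac (hKvol.const_mul _), hsplit, integral_const_mul (szegoDeriv σ z) K,
      integral_fejerKernel_comp hr z]
    ring
  rw [edist_eq_enorm_sub, hdiff, deviationMeasure, lintegral_add_measure,
    lintegral_withDensity_eq_lintegral_mul _ (by fun_prop) (by fun_prop)]
  refine (enorm_add_le _ _).trans (add_le_add ?_ ?_)
  · refine (enorm_integral_le_lintegral_enorm _).trans_eq (lintegral_congr fun x => ?_)
    rw [enorm_mul, Real.enorm_of_nonneg (hK0 x), Pi.mul_apply]
  · refine (enorm_integral_le_lintegral_enorm _).trans_eq (lintegral_congr fun x => ?_)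
    rw [Real.enorm_of_nonneg (hK0 x)]

/-- Continuous Fejér kernel property: `(Φ_r * σ)(z) → 2π σ′(z)` for a.e. `z ∈ ℝ`,
where `Φ_r(x) = r Φ(r x)`. -/
theorem fejer_approximate_identity
    (σ : Measure ℝ)
    (hσ : Integrable (fun x : ℝ => 1 / (1 + x ^ 2)) σ) :
    ∀ᵐ z : ℝ, Tendsto (fun r : ℝ => ∫ x : ℝ, r * fejerKernel (r * (z - x)) ∂σ)
      atTop (nhds (2 * Real.pi * szegoDeriv σ z)) := by
  have := isLocallyFiniteMeasure_of_integrable_one_div_one_add_sq hσ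
  filter_upwards [ae_tendsto_deviationMeasure_div σ] with z hz
  refine tendsto_iff_edist_tendsto_0.2 ?_
  refine tendsto_of_tendsto_of_tendsto_of_le_of_le' tendsto_const_nhds
    (tendsto_lintegral_fejerKernel_zero (lintegral_deviationMeasure_ne_top hσ z) hz)
    (Eventually.of_forall fun _ => zero_le) ?_
  filter_upwards [eventually_gt_atTop 0] with r hr using edist_integral_fejerKernel_le hσ hr z
end
end

section
/- Let a ∈ L¹_loc([0,∞); ℂ), let P, P_* be the solutions of the Krein system with coefficient a, and fix r > 0. Define K_r(z′, z) = ∫₀^r conj(P(s, z′)) P(s, z) ds and f_r(z) = K_r(0, z)/K_r(0, 0). Then for every t ∈ ℝ and every γ > 0 one has |f_r(t)| ≤ |f_r(t + iγ)| e^{γ r}. -/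
open MeasureTheory Filter

noncomputable section

/-- A Krein system with coefficient `a ∈ L¹_loc([0,∞); ℂ)`, in integral form:
`P` and `Ps` (= `P_*`) are locally absolutely continuous in `r` and satisfy
`∂P/∂r = iλP - conj(a)P_*`, `P(0,λ)=1` and `∂P_*/∂r = -aP`, `P_*(0,λ)=1`. -/
def IsKreinSystem (a : ℝ → ℂ) (P Ps : ℝ → ℂ → ℂ) : Prop :=
  MeasureTheory.LocallyIntegrableOn a (Set.Ici 0) ∧
  (∀ z : ℂ, ContinuousOn (fun r => P r z) (Set.Ici 0)) ∧
  (∀ z : ℂ, ContinuousOn (fun r => Ps r z) (Set.Ici 0)) ∧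
  ∀ z : ℂ, ∀ r : ℝ, 0 ≤ r →
    (P r z = 1 + ∫ s in (0:ℝ)..r,
        (Complex.I * z * P s z - (starRingEnd ℂ) (a s) * Ps s z)) ∧
    (Ps r z = 1 - ∫ s in (0:ℝ)..r, a s * P s z)

/-- The Christoffel–Darboux kernel `K_r(z′, z) = ∫₀^r conj(P(s,z′)) P(s,z) ds`. -/
def kreinK (P : ℝ → ℂ → ℂ) (r : ℝ) (z' z : ℂ) : ℂ :=
  ∫ s in (0:ℝ)..r, (starRingEnd ℂ) (P s z') * P s z

/-- The extremal function `f_r(z) = K_r(0,z)/K_r(0,0)`. -/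
def kreinf (P : ℝ → ℂ → ℂ) (r : ℝ) (z : ℂ) : ℂ := kreinK P r 0 z / kreinK P r 0 0

theorem AbsolutelyContinuousOnInterval.of_dist_le {X Y : Type*} [PseudoMetricSpace X]
    [PseudoMetricSpace Y] {f : ℝ → X} {g : ℝ → Y} {a b K : ℝ}
    (hg : AbsolutelyContinuousOnInterval g a b)
    (h : ∀ x ∈ Set.uIcc a b, ∀ y ∈ Set.uIcc a b, dist (f x) (f y) ≤ K * dist (g x) (g y)) :
    AbsolutelyContinuousOnInterval f a b := by
  unfold AbsolutelyContinuousOnInterval at hg ⊢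
  apply squeeze_zero' ?_ ?_ (by simpa using hg.const_mul K)
  · exact Filter.Eventually.of_forall fun _ ↦ Finset.sum_nonneg fun i hi ↦ dist_nonneg
  rw [eventually_inf_principal]
  filter_upwards with E hE
  rw [Finset.mul_sum]
  gcongr with i hi
  exact h _ (hE.1 i hi).1 _ (hE.1 i hi).2

theorem IntervalIntegrable.absolutelyContinuousOnInterval_integral {E : Type*}
    [NormedAddCommGroup E] [NormedSpace ℝ E] {f : ℝ → E} {a b : ℝ}
    (hf : IntervalIntegrable f volume a b) :
    AbsolutelyContinuousOnInterval (fun x ↦ ∫ t in a..x, f t) a b := by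
  refine AbsolutelyContinuousOnInterval.of_dist_le (K := 1)
    (hf.norm.absolutelyContinuousOnInterval_intervalIntegral (c := a) Set.left_mem_uIcc) ?_
  intro x hx y hy
  have hax : IntervalIntegrable f volume a x :=
    hf.mono_set (Set.uIcc_subset_uIcc Set.left_mem_uIcc hx)
  have hay : IntervalIntegrable f volume a y :=
    hf.mono_set (Set.uIcc_subset_uIcc Set.left_mem_uIcc hy)
  rw [one_mul, dist_eq_norm, Real.dist_eq, intervalIntegral.integral_interval_sub_left hax hay,
    intervalIntegral.integral_interval_sub_left hax.norm hay.norm]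
  exact intervalIntegral.norm_integral_le_abs_integral_norm

theorem AbsolutelyContinuousOnInterval.integral_eq_sub_of_ae_hasDerivAt {E : Type*}
    [NormedAddCommGroup E] [NormedSpace ℝ E] [CompleteSpace E] {f f' : ℝ → E} {a b : ℝ}
    (hf : AbsolutelyContinuousOnInterval f a b)
    (hd : ∀ᵐ x, x ∈ Set.uIcc a b → HasDerivAt f (f' x) x)
    (hi : IntervalIntegrable f' volume a b) :
    ∫ x in a..b, f' x = f b - f a := by
  have hg := hf.sub hi.absolutelyContinuousOnInterval_integral
  have hz : ∀ᵐ x, x ∈ Set.uIcc a b →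
      HasDerivAt (f - fun x ↦ ∫ t in a..x, f' t) 0 x := by
    filter_upwards [hd, hi.ae_hasDerivAt_integral] with x h1 h2 hx
    simpa using (h1 hx).sub (h2 hx a Set.left_mem_uIcc)
  obtain ⟨C, hC⟩ := hg.const_of_ae_hasDerivAt_zero hz
  have h1 := hC a Set.left_mem_uIcc
  have h2 := hC b Set.right_mem_uIcc
  simp only [Pi.sub_apply, intervalIntegral.integral_same, sub_zero] at h1 h2
  rw [h1, ← h2]
  abel

/-- The product rule in integral form. -/
theorem mul_eq_integral_of_eq_integral {u v u' v' : ℝ → ℂ} {u₀ v₀ : ℂ} {r : ℝ} (hr : 0 ≤ r)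
    (hu' : IntervalIntegrable u' volume 0 r) (hv' : IntervalIntegrable v' volume 0 r)
    (hu : ∀ s ∈ Set.Icc 0 r, u s = u₀ + ∫ x in (0 : ℝ)..s, u' x)
    (hv : ∀ s ∈ Set.Icc 0 r, v s = v₀ + ∫ x in (0 : ℝ)..s, v' x) :
    u r * v r = u₀ * v₀ + ∫ x in (0 : ℝ)..r, (u' x * v x + u x * v' x) := by
  have hsub : Set.uIcc 0 r = Set.Icc 0 r := Set.uIcc_of_le hr
  have acu : AbsolutelyContinuousOnInterval (fun s ↦ u₀ + ∫ x in (0 : ℝ)..s, u' x) 0 r :=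
    hu'.absolutelyContinuousOnInterval_integral.of_dist_le (K := 1) (by simp)
  have acv : AbsolutelyContinuousOnInterval (fun s ↦ v₀ + ∫ x in (0 : ℝ)..s, v' x) 0 r :=
    hv'.absolutelyContinuousOnInterval_integral.of_dist_le (K := 1) (by simp)
  have key := (acu.fun_smul acv).integral_eq_sub_of_ae_hasDerivAt
    (f' := fun x ↦ u' x * (v₀ + ∫ t in (0 : ℝ)..x, v' t) + (u₀ + ∫ t in (0 : ℝ)..x, u' t) * v' x)
    (by
      filter_upwards [hu'.ae_hasDerivAt_integral, hv'.ae_hasDerivAt_integral] with x h1 h2 hx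
      exact ((h1 hx 0 Set.left_mem_uIcc).const_add u₀).mul
        ((h2 hx 0 Set.left_mem_uIcc).const_add v₀))
    ((hu'.mul_continuousOn acv.continuousOn).add (hv'.continuousOn_mul acu.continuousOn))
  rw [hu r ⟨hr, le_rfl⟩, hv r ⟨hr, le_rfl⟩]
  simp only [smul_eq_mul, intervalIntegral.integral_same, add_zero] at key
  rw [← sub_eq_iff_eq_add', ← key]
  refine intervalIntegral.integral_congr fun x hx ↦ ?_
  rw [hsub] at hx
  simp only [hu x hx, hv x hx]

/-- Grönwall's inequality in integral form, with an integrable rate. -/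
theorem le_mul_exp_integral_of_le_add_integral {u κ : ℝ → ℝ} {δ r : ℝ} (hr : 0 ≤ r)
    (hκ : IntervalIntegrable κ volume 0 r) (hκ0 : ∀ x, 0 ≤ κ x)
    (hu : ContinuousOn u (Set.Icc 0 r))
    (h : ∀ s ∈ Set.Icc 0 r, u s ≤ δ + ∫ x in (0 : ℝ)..s, κ x * u x) :
    u r ≤ δ * Real.exp (∫ x in (0 : ℝ)..r, κ x) := by
  have hsub : Set.uIcc 0 r = Set.Icc 0 r := Set.uIcc_of_le hr
  have hκu : IntervalIntegrable (fun x ↦ κ x * u x) volume 0 r :=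
    hκ.mul_continuousOn (hsub ▸ hu)
  have acV : AbsolutelyContinuousOnInterval (fun s ↦ δ + ∫ x in (0 : ℝ)..s, κ x * u x) 0 r :=
    hκu.absolutelyContinuousOnInterval_integral.of_dist_le (K := 1) (by simp)
  have hΦ0 : ∀ s ∈ Set.Icc 0 r, 0 ≤ ∫ x in (0 : ℝ)..s, κ x := fun s hs ↦
    intervalIntegral.integral_nonneg hs.1 fun x _ ↦ hκ0 x
  have acE : AbsolutelyContinuousOnInterval (fun s ↦ Real.exp (-∫ x in (0 : ℝ)..s, κ x)) 0 r := by
    refine hκ.absolutelyContinuousOnInterval_integral.of_dist_le (K := 1) ?_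
    rw [hsub]
    have aux : ∀ p q : ℝ, 0 ≤ p → p ≤ q → |Real.exp (-p) - Real.exp (-q)| ≤ |p - q| := by
      intro p q hp hpq
      have h1 : Real.exp (-q) = Real.exp (-p) * Real.exp (-(q - p)) := by
        rw [← Real.exp_add]; ring_nf
      have h2 := Real.add_one_le_exp (-(q - p))
      have h3 : Real.exp (-p) ≤ 1 := Real.exp_le_one_iff.2 (by linarith)
      have h4 : Real.exp (-(q - p)) ≤ 1 := Real.exp_le_one_iff.2 (by linarith)
      have h5 := Real.exp_pos (-p)
      rw [abs_of_nonneg (by nlinarith), abs_of_nonpos (by linarith)]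
      nlinarith
    intro x hx y hy
    rw [one_mul, Real.dist_eq, Real.dist_eq]
    rcases le_total (∫ t in (0 : ℝ)..x, κ t) (∫ t in (0 : ℝ)..y, κ t) with hxy | hxy
    · exact aux _ _ (hΦ0 x hx) hxy
    · rw [abs_sub_comm, abs_sub_comm (∫ t in (0 : ℝ)..x, κ t)]
      exact aux _ _ (hΦ0 y hy) hxy
  have hint : IntervalIntegrable (fun x ↦
      κ x * u x * Real.exp (-∫ t in (0 : ℝ)..x, κ t) +
        (δ + ∫ t in (0 : ℝ)..x, κ t * u t) * (Real.exp (-∫ t in (0 : ℝ)..x, κ t) * -κ x))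
      volume 0 r :=
    (hκu.mul_continuousOn acE.continuousOn).add
      ((hκ.neg.continuousOn_mul acE.continuousOn).continuousOn_mul acV.continuousOn)
  have key := (acV.fun_mul acE).integral_eq_sub_of_ae_hasDerivAt (by
      filter_upwards [hκu.ae_hasDerivAt_integral, hκ.ae_hasDerivAt_integral] with x h1 h2 hx
      exact ((h1 hx 0 Set.left_mem_uIcc).const_add δ).mul
        (h2 hx 0 Set.left_mem_uIcc).fun_neg.exp) hint
  have hneg : ∫ x in (0 : ℝ)..r, (κ x * u x * Real.exp (-∫ t in (0 : ℝ)..x, κ t) +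
        (δ + ∫ t in (0 : ℝ)..x, κ t * u t) * (Real.exp (-∫ t in (0 : ℝ)..x, κ t) * -κ x)) ≤ 0 := by
    rw [← neg_nonneg, ← intervalIntegral.integral_neg]
    refine intervalIntegral.integral_nonneg hr fun x hx ↦ ?_
    have h1 := h x hx
    have h2 := mul_nonneg (Real.exp_pos (-∫ t in (0 : ℝ)..x, κ t)).le (hκ0 x)
    nlinarith
  rw [key] at hneg
  simp only [intervalIntegral.integral_same, neg_zero, Real.exp_zero, mul_one, add_zero,
    sub_nonpos] at hneg
  refine (h r ⟨hr, le_rfl⟩).trans ?_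
  rwa [Real.exp_neg, ← div_eq_mul_inv, div_le_iff₀ (Real.exp_pos _)] at hneg

theorem IntervalIntegrable.conj {f : ℝ → ℂ} {b c : ℝ} (hf : IntervalIntegrable f volume b c) :
    IntervalIntegrable (fun x ↦ (starRingEnd ℂ) (f x)) volume b c :=
  ⟨Complex.conjCLE.toContinuousLinearMap.integrable_comp hf.1,
    Complex.conjCLE.toContinuousLinearMap.integrable_comp hf.2⟩

theorem intervalIntegral_conj {f : ℝ → ℂ} {b c : ℝ} :
    ∫ x in b..c, (starRingEnd ℂ) (f x) = (starRingEnd ℂ) (∫ x in b..c, f x) := by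
  simp only [intervalIntegral, integral_conj, map_sub]

/-- Stability estimate for a forced Krein system with zero initial data. -/
theorem norm_add_norm_le_of_forced_krein {a u v F : ℝ → ℂ} {z : ℂ} {δ r : ℝ} (hr : 0 ≤ r)
    (ha : IntervalIntegrable a volume 0 r)
    (hu : ContinuousOn u (Set.Icc 0 r)) (hv : ContinuousOn v (Set.Icc 0 r))
    (hF : ContinuousOn F (Set.Icc 0 r)) (hδ : ∀ s ∈ Set.Icc 0 r, ‖F s‖ ≤ δ)
    (hu' : ∀ s ∈ Set.Icc 0 r, u s = ∫ x in (0 : ℝ)..s,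
      (Complex.I * z * u x - (starRingEnd ℂ) (a x) * v x + F x))
    (hv' : ∀ s ∈ Set.Icc 0 r, v s = -∫ x in (0 : ℝ)..s, a x * u x) :
    ‖u r‖ + ‖v r‖ ≤ δ * r * Real.exp (‖z‖ * r + ∫ x in (0 : ℝ)..r, ‖a x‖) := by
  have hδ0 : 0 ≤ δ := (norm_nonneg _).trans (hδ 0 ⟨le_rfl, hr⟩)
  have hg := le_mul_exp_integral_of_le_add_integral (u := fun s ↦ ‖u s‖ + ‖v s‖)
    (κ := fun x ↦ ‖z‖ + ‖a x‖) (δ := δ * r) hr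
    (intervalIntegrable_const.add ha.norm) (fun x ↦ by positivity) (hu.norm.add hv.norm) ?_
  · rw [intervalIntegral.integral_add intervalIntegrable_const ha.norm] at hg
    simpa [mul_comm] using hg
  intro s hs
  have hsub : Set.uIcc 0 s ⊆ Set.Icc 0 r := by
    rw [Set.uIcc_of_le hs.1]; exact Set.Icc_subset_Icc_right hs.2
  have has : IntervalIntegrable a volume 0 s :=
    ha.mono_set (by rwa [Set.uIcc_of_le hr])
  have hus := hu.mono hsub
  have hvs := hv.mono hsub
  have hFs := hF.mono hsub
  have i1 : IntervalIntegrable (fun x ↦ ‖z‖ * ‖u x‖ + ‖a x‖ * ‖v x‖ + δ) volume 0 s :=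
    ((hus.norm.intervalIntegrable.const_mul _).add (has.norm.mul_continuousOn hvs.norm)).add
      intervalIntegrable_const
  have i2 : IntervalIntegrable (fun x ↦ ‖a x‖ * ‖u x‖) volume 0 s :=
    has.norm.mul_continuousOn hus.norm
  have b1 : ‖u s‖ ≤ ∫ x in (0 : ℝ)..s, (‖z‖ * ‖u x‖ + ‖a x‖ * ‖v x‖ + δ) := by
    rw [hu' s hs]
    refine intervalIntegral.norm_integral_le_of_norm_le hs.1 (ae_of_all _ fun x hx ↦ ?_) i1
    refine (norm_add_le _ _).trans (add_le_add ((norm_sub_le _ _).trans ?_)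
      (hδ x ⟨hx.1.le, hx.2.trans hs.2⟩))
    simp
  have b2 : ‖v s‖ ≤ ∫ x in (0 : ℝ)..s, ‖a x‖ * ‖u x‖ := by
    rw [hv' s hs, norm_neg]
    refine intervalIntegral.norm_integral_le_of_norm_le hs.1 (ae_of_all _ fun x hx ↦ ?_) i2
    simp
  have i3 : IntervalIntegrable (fun x ↦ (‖z‖ + ‖a x‖) * (‖u x‖ + ‖v x‖)) volume 0 s :=
    (intervalIntegrable_const.add has.norm).mul_continuousOn (hus.norm.add hvs.norm)
  calc ‖u s‖ + ‖v s‖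
      ≤ (∫ x in (0 : ℝ)..s, (‖z‖ * ‖u x‖ + ‖a x‖ * ‖v x‖ + δ)) +
        ∫ x in (0 : ℝ)..s, ‖a x‖ * ‖u x‖ := add_le_add b1 b2
    _ = ∫ x in (0 : ℝ)..s, ((‖z‖ * ‖u x‖ + ‖a x‖ * ‖v x‖ + δ) + ‖a x‖ * ‖u x‖) :=
        (intervalIntegral.integral_add i1 i2).symm
    _ ≤ ∫ x in (0 : ℝ)..s, (δ + (‖z‖ + ‖a x‖) * (‖u x‖ + ‖v x‖)) := by
        refine intervalIntegral.integral_mono_on hs.1 (i1.add i2)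
          (intervalIntegrable_const.add i3) fun x _ ↦ ?_
        have : 0 ≤ ‖z‖ * ‖v x‖ := by positivity
        linarith
    _ = δ * s + ∫ x in (0 : ℝ)..s, (‖z‖ + ‖a x‖) * (‖u x‖ + ‖v x‖) := by
        rw [intervalIntegral.integral_add intervalIntegrable_const i3]
        simp [mul_comm]
    _ ≤ δ * r + ∫ x in (0 : ℝ)..s, (‖z‖ + ‖a x‖) * (‖u x‖ + ‖v x‖) := by
        gcongr; exact hs.2

namespace IsKreinSystem

variable {a : ℝ → ℂ} {P Ps : ℝ → ℂ → ℂ} {r : ℝ}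

theorem intervalIntegrable (hK : IsKreinSystem a P Ps) (hr : 0 ≤ r) :
    IntervalIntegrable a volume 0 r := by
  rw [intervalIntegrable_iff_integrableOn_Icc_of_le hr]
  exact hK.1.integrableOn_compact_subset Set.Icc_subset_Ici_self isCompact_Icc

theorem continuousOn (hK : IsKreinSystem a P Ps) (z : ℂ) :
    ContinuousOn (fun s ↦ P s z) (Set.Icc 0 r) :=
  (hK.2.1 z).mono Set.Icc_subset_Ici_self

theorem continuousOn_star (hK : IsKreinSystem a P Ps) (z : ℂ) :
    ContinuousOn (fun s ↦ Ps s z) (Set.Icc 0 r) :=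
  (hK.2.2.1 z).mono Set.Icc_subset_Ici_self

theorem intervalIntegrable_deriv (hK : IsKreinSystem a P Ps) (hr : 0 ≤ r) (z : ℂ) :
    IntervalIntegrable (fun s ↦ Complex.I * z * P s z - (starRingEnd ℂ) (a s) * Ps s z)
      volume 0 r := by
  have h1 : ContinuousOn (fun s ↦ P s z) (Set.uIcc 0 r) :=
    Set.uIcc_of_le hr ▸ hK.continuousOn z
  have h2 : ContinuousOn (fun s ↦ Ps s z) (Set.uIcc 0 r) :=
    Set.uIcc_of_le hr ▸ hK.continuousOn_star z
  exact (h1.intervalIntegrable.const_mul _).sub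
    ((hK.intervalIntegrable hr).conj.mul_continuousOn h2)

theorem intervalIntegrable_mul (hK : IsKreinSystem a P Ps) (hr : 0 ≤ r) (z : ℂ) :
    IntervalIntegrable (fun s ↦ a s * P s z) volume 0 r := by
  have h1 : ContinuousOn (fun s ↦ P s z) (Set.uIcc 0 r) :=
    Set.uIcc_of_le hr ▸ hK.continuousOn z
  exact (hK.intervalIntegrable hr).mul_continuousOn h1

theorem intervalIntegrable_neg_mul (hK : IsKreinSystem a P Ps) (hr : 0 ≤ r) (z : ℂ) :
    IntervalIntegrable (fun s ↦ -(a s * P s z)) volume 0 r :=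
  (hK.intervalIntegrable_mul hr z).neg

theorem eq_integral (hK : IsKreinSystem a P Ps) (z : ℂ) (hr : 0 ≤ r) :
    P r z = 1 + ∫ s in (0 : ℝ)..r,
      (Complex.I * z * P s z - (starRingEnd ℂ) (a s) * Ps s z) :=
  (hK.2.2.2 z r hr).1

theorem star_eq_integral (hK : IsKreinSystem a P Ps) (z : ℂ) (hr : 0 ≤ r) :
    Ps r z = 1 + ∫ s in (0 : ℝ)..r, -(a s * P s z) := by
  rw [(hK.2.2.2 z r hr).2, intervalIntegral.integral_neg, sub_eq_add_neg]

theorem conj_eq_integral (hK : IsKreinSystem a P Ps) (z : ℂ) (hr : 0 ≤ r) :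
    (starRingEnd ℂ) (P r z) = 1 + ∫ s in (0 : ℝ)..r,
      (starRingEnd ℂ) (Complex.I * z * P s z - (starRingEnd ℂ) (a s) * Ps s z) := by
  rw [intervalIntegral_conj, hK.eq_integral z hr]; simp

theorem conj_star_eq_integral (hK : IsKreinSystem a P Ps) (z : ℂ) (hr : 0 ≤ r) :
    (starRingEnd ℂ) (Ps r z) = 1 + ∫ s in (0 : ℝ)..r, (starRingEnd ℂ) (-(a s * P s z)) := by
  rw [intervalIntegral_conj, hK.star_eq_integral z hr]; simp

theorem intervalIntegrable_kernel (hK : IsKreinSystem a P Ps) (hr : 0 ≤ r) (w z : ℂ) :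
    IntervalIntegrable (fun s ↦ (starRingEnd ℂ) (P s w) * P s z) volume 0 r := by
  refine ContinuousOn.intervalIntegrable ?_
  rw [Set.uIcc_of_le hr]
  exact (Complex.continuous_conj.comp_continuousOn (hK.continuousOn w)).mul (hK.continuousOn z)

/-- The Christoffel–Darboux formula. -/
theorem christoffel_darboux (hK : IsKreinSystem a P Ps) (hr : 0 ≤ r) (w z : ℂ) :
    P r z * (starRingEnd ℂ) (P r w) - Ps r z * (starRingEnd ℂ) (Ps r w) =
      Complex.I * (z - (starRingEnd ℂ) w) * kreinK P r w z := by
  have hsub : Set.uIcc 0 r = Set.Icc 0 r := Set.uIcc_of_le hr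
  have cP (z : ℂ) : ContinuousOn (fun s ↦ P s z) (Set.uIcc 0 r) := hsub ▸ hK.continuousOn z
  have cS (z : ℂ) : ContinuousOn (fun s ↦ Ps s z) (Set.uIcc 0 r) := hsub ▸ hK.continuousOn_star z
  have dP := hK.intervalIntegrable_deriv hr
  have dS := hK.intervalIntegrable_neg_mul hr
  have h1 := mul_eq_integral_of_eq_integral hr (dP z) (dP w).conj
    (fun s hs ↦ hK.eq_integral z hs.1) (fun s hs ↦ hK.conj_eq_integral w hs.1)
  have h2 := mul_eq_integral_of_eq_integral hr (dS z) (dS w).conj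
    (fun s hs ↦ hK.star_eq_integral z hs.1) (fun s hs ↦ hK.conj_star_eq_integral w hs.1)
  rw [h1, h2, add_sub_add_left_eq_sub, ← intervalIntegral.integral_sub, kreinK,
    ← intervalIntegral.integral_const_mul]
  · refine intervalIntegral.integral_congr fun x _ ↦ ?_
    simp only [map_sub, map_mul, map_neg, Complex.conj_I, Complex.conj_conj]
    ring
  · exact ((dP z).mul_continuousOn (Complex.continuous_conj.comp_continuousOn (cP w))).add
      ((dP w).conj.continuousOn_mul (cP z))
  · exact ((dS z).mul_continuousOn (Complex.continuous_conj.comp_continuousOn (cS w))).add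
      ((dS w).conj.continuousOn_mul (cS z))

theorem _root_.kreinK_self (P : ℝ → ℂ → ℂ) (r : ℝ) (z : ℂ) :
    kreinK P r z z = ((∫ s in (0 : ℝ)..r, ‖P s z‖ ^ 2 : ℝ) : ℂ) := by
  rw [kreinK, ← intervalIntegral.integral_ofReal]
  refine intervalIntegral.integral_congr fun x _ ↦ ?_
  simp only [Complex.conj_mul']
  norm_cast

theorem sq_norm_star_sub_sq_norm (hK : IsKreinSystem a P Ps) (hr : 0 ≤ r) (z : ℂ) :
    ‖Ps r z‖ ^ 2 - ‖P r z‖ ^ 2 = 2 * z.im * ∫ s in (0 : ℝ)..r, ‖P s z‖ ^ 2 := by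
  have h := hK.christoffel_darboux hr z z
  rw [kreinK_self, Complex.mul_conj', Complex.mul_conj', Complex.sub_conj] at h
  have h2 : ((‖P r z‖ ^ 2 - ‖Ps r z‖ ^ 2 : ℝ) : ℂ) =
      ((-(2 * z.im * ∫ s in (0 : ℝ)..r, ‖P s z‖ ^ 2) : ℝ) : ℂ) := by
    push_cast
    rw [h]
    push_cast
    linear_combination (2 * z.im * (∫ s in (0 : ℝ)..r, ‖P s z‖ ^ 2 : ℝ) : ℂ) * Complex.I_sq
  have h3 := Complex.ofReal_injective h2
  linarith

/-- The reflection `P(λ) = e^{irλ} conj P_*(conj λ)`, `P_*(λ) = e^{irλ} conj P(conj λ)`. -/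
theorem reflection (hK : IsKreinSystem a P Ps) (hr : 0 ≤ r) (z : ℂ) :
    P r z = Complex.exp (Complex.I * z * r) * (starRingEnd ℂ) (Ps r ((starRingEnd ℂ) z)) ∧
    Ps r z = Complex.exp (Complex.I * z * r) * (starRingEnd ℂ) (P r ((starRingEnd ℂ) z)) := by
  set w := (starRingEnd ℂ) z with hw
  have hcE : Continuous fun s : ℝ ↦ Complex.exp (Complex.I * z * s) := by fun_prop
  have dE : IntervalIntegrable (fun s : ℝ ↦ Complex.exp (Complex.I * z * s) * (Complex.I * z))
      volume 0 r := (by fun_prop : Continuous _).intervalIntegrable 0 r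
  have hE (s : ℝ) : Complex.exp (Complex.I * z * s) =
      1 + ∫ x in (0 : ℝ)..s, Complex.exp (Complex.I * z * x) * (Complex.I * z) := by
    rw [intervalIntegral.integral_eq_sub_of_hasDerivAt
      (f := fun s : ℝ ↦ Complex.exp (Complex.I * z * s))]
    · simp
    · intro x _
      have := ((Complex.ofRealCLM.hasDerivAt (x := x)).const_mul (Complex.I * z)).cexp
      simpa using this
    · exact (by fun_prop : Continuous _).intervalIntegrable 0 s
  have cP (z : ℂ) : ContinuousOn (fun s ↦ P s z) (Set.Icc 0 r) := hK.continuousOn z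
  have cS (z : ℂ) : ContinuousOn (fun s ↦ Ps s z) (Set.Icc 0 r) := hK.continuousOn_star z
  have ccP := Complex.continuous_conj.comp_continuousOn (cP w)
  have ccS := Complex.continuous_conj.comp_continuousOn (cS w)
  have hsub {s : ℝ} (hs : s ∈ Set.Icc 0 r) : Set.uIcc 0 s ⊆ Set.uIcc 0 r := by
    rw [Set.uIcc_of_le hr, Set.uIcc_of_le hs.1]; exact Set.Icc_subset_Icc_right hs.2
  have key := norm_add_norm_le_of_forced_krein (a := a)
    (u := fun s ↦ P s z - Complex.exp (Complex.I * z * s) * (starRingEnd ℂ) (Ps s w))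
    (v := fun s ↦ Ps s z - Complex.exp (Complex.I * z * s) * (starRingEnd ℂ) (P s w))
    (F := 0) (z := z) (δ := 0) hr (hK.intervalIntegrable hr)
    ((cP z).sub (hcE.continuousOn.mul ccS)) ((cS z).sub (hcE.continuousOn.mul ccP))
    continuousOn_const (by simp) ?_ ?_
  · simp only [zero_mul] at key
    have h1 := norm_nonneg (P r z - Complex.exp (Complex.I * z * r) * (starRingEnd ℂ) (Ps r w))
    have h2 := norm_nonneg (Ps r z - Complex.exp (Complex.I * z * r) * (starRingEnd ℂ) (P r w))
    exact ⟨sub_eq_zero.1 (norm_eq_zero.1 (by linarith)),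
      sub_eq_zero.1 (norm_eq_zero.1 (by linarith))⟩
  · intro s hs
    have dS := (hK.intervalIntegrable_neg_mul hs.1 w).conj
    have dE' := dE.mono_set (hsub hs)
    have h := mul_eq_integral_of_eq_integral hs.1 dE' dS
      (fun x hx ↦ hE x) (fun x hx ↦ hK.conj_star_eq_integral w hx.1)
    simp only [h]
    rw [hK.eq_integral z hs.1, one_mul, add_sub_add_left_eq_sub, ← intervalIntegral.integral_sub]
    · refine intervalIntegral.integral_congr fun x _ ↦ ?_
      simp only [Pi.zero_apply, map_mul, map_neg]
      ring
    · exact hK.intervalIntegrable_deriv hs.1 z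
    · exact (dE'.mul_continuousOn (ccS.mono (Set.uIcc_of_le hr ▸ hsub hs))).add
        (dS.continuousOn_mul hcE.continuousOn)
  · intro s hs
    have dP := (hK.intervalIntegrable_deriv hs.1 w).conj
    have dE' := dE.mono_set (hsub hs)
    have h := mul_eq_integral_of_eq_integral hs.1 dE' dP
      (fun x hx ↦ hE x) (fun x hx ↦ hK.conj_eq_integral w hx.1)
    simp only [h]
    rw [hK.star_eq_integral z hs.1, one_mul, add_sub_add_left_eq_sub,
      ← intervalIntegral.integral_sub, ← intervalIntegral.integral_neg]
    · refine intervalIntegral.integral_congr fun x _ ↦ ?_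
      simp only [map_sub, map_mul, Complex.conj_I, Complex.conj_conj, hw]
      ring
    · exact hK.intervalIntegrable_neg_mul hs.1 z
    · exact (dE'.mul_continuousOn (ccP.mono (Set.uIcc_of_le hr ▸ hsub hs))).add
        (dP.continuousOn_mul hcE.continuousOn)

theorem exists_norm_le (hK : IsKreinSystem a P Ps) (hr : 0 ≤ r) (w : ℂ) :
    ∃ M, 0 ≤ M ∧ ∀ s ∈ Set.Icc 0 r, ‖P s w‖ ≤ M := by
  obtain ⟨M, hM⟩ := isCompact_Icc.exists_bound_of_continuousOn (hK.continuousOn (r := r) w)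
  exact ⟨M, (norm_nonneg _).trans (hM 0 ⟨le_rfl, hr⟩), hM⟩

theorem integral_norm_coeff_mono (hK : IsKreinSystem a P Ps) {s : ℝ} (hs : s ∈ Set.Icc 0 r) :
    ∫ x in (0 : ℝ)..s, ‖a x‖ ≤ ∫ x in (0 : ℝ)..r, ‖a x‖ :=
  intervalIntegral.integral_mono_interval le_rfl hs.1 hs.2
    (ae_of_all _ fun x ↦ norm_nonneg (a x)) (hK.intervalIntegrable (hs.1.trans hs.2)).norm

/-- `P` is locally Lipschitz in the spectral parameter. -/
theorem norm_eval_sub_le (hK : IsKreinSystem a P Ps) {w : ℂ} {M : ℝ}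
    (hM : ∀ s ∈ Set.Icc 0 r, ‖P s w‖ ≤ M) (z : ℂ) {s : ℝ} (hs : s ∈ Set.Icc 0 r) :
    ‖P s z - P s w‖ ≤
      ‖z - w‖ * (M * r * Real.exp (‖z‖ * r + ∫ x in (0 : ℝ)..r, ‖a x‖)) := by
  have hM0 : 0 ≤ M := (norm_nonneg _).trans (hM s hs)
  have hr : 0 ≤ r := hs.1.trans hs.2
  have key := norm_add_norm_le_of_forced_krein (a := a) (r := s)
    (u := fun s ↦ P s z - P s w) (v := fun s ↦ Ps s z - Ps s w)
    (F := fun s ↦ Complex.I * (z - w) * P s w) (z := z) (δ := ‖z - w‖ * M) hs.1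
    (hK.intervalIntegrable hs.1) ((hK.continuousOn z).sub (hK.continuousOn w))
    ((hK.continuousOn_star z).sub (hK.continuousOn_star w))
    (continuousOn_const.mul (hK.continuousOn w)) ?_ ?_ ?_
  · calc ‖P s z - P s w‖ ≤ ‖P s z - P s w‖ + ‖Ps s z - Ps s w‖ :=
        le_add_of_nonneg_right (norm_nonneg _)
      _ ≤ _ := key
      _ ≤ ‖z - w‖ * M * r * Real.exp (‖z‖ * r + ∫ x in (0 : ℝ)..r, ‖a x‖) := by
        gcongr
        · exact hs.2
        · exact hs.2
        · exact hK.integral_norm_coeff_mono hs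
      _ = _ := by ring
  · intro x hx
    simp only [norm_mul, Complex.norm_I, one_mul]
    gcongr
    exact hM x ⟨hx.1, hx.2.trans hs.2⟩
  · intro x hx
    rw [hK.eq_integral z hx.1, hK.eq_integral w hx.1, add_sub_add_left_eq_sub,
      ← intervalIntegral.integral_sub (hK.intervalIntegrable_deriv hx.1 z)
        (hK.intervalIntegrable_deriv hx.1 w)]
    refine intervalIntegral.integral_congr fun y _ ↦ ?_
    ring
  · intro x hx
    rw [hK.star_eq_integral z hx.1, hK.star_eq_integral w hx.1, add_sub_add_left_eq_sub,
      ← intervalIntegral.integral_sub (hK.intervalIntegrable_neg_mul hx.1 z)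
        (hK.intervalIntegrable_neg_mul hx.1 w), ← intervalIntegral.integral_neg]
    refine intervalIntegral.integral_congr fun y _ ↦ ?_
    ring

theorem norm_slope_sub_slope_le (hK : IsKreinSystem a P Ps) {w z₁ z₂ : ℂ} (h₁ : z₁ ≠ w)
    (h₂ : z₂ ≠ w) {δ : ℝ} (hδ : ∀ s ∈ Set.Icc 0 r, ‖P s z₁ - P s z₂‖ ≤ δ) {s : ℝ}
    (hs : s ∈ Set.Icc 0 r) :
    ‖(z₁ - w)⁻¹ * (P s z₁ - P s w) - (z₂ - w)⁻¹ * (P s z₂ - P s w)‖ ≤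
      δ * (r * Real.exp (‖w‖ * r + ∫ x in (0 : ℝ)..r, ‖a x‖)) := by
  have hδ0 : 0 ≤ δ := (norm_nonneg _).trans (hδ s hs)
  have hr : 0 ≤ r := hs.1.trans hs.2
  have h₁' := sub_ne_zero.2 h₁
  have h₂' := sub_ne_zero.2 h₂
  have key := norm_add_norm_le_of_forced_krein (a := a) (r := s)
    (u := fun s ↦ (z₁ - w)⁻¹ * (P s z₁ - P s w) - (z₂ - w)⁻¹ * (P s z₂ - P s w))
    (v := fun s ↦ (z₁ - w)⁻¹ * (Ps s z₁ - Ps s w) - (z₂ - w)⁻¹ * (Ps s z₂ - Ps s w))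
    (F := fun s ↦ Complex.I * (P s z₁ - P s z₂)) (z := w) (δ := δ) hs.1
    (hK.intervalIntegrable hs.1)
    ((continuousOn_const.mul ((hK.continuousOn _).sub (hK.continuousOn _))).sub
      (continuousOn_const.mul ((hK.continuousOn _).sub (hK.continuousOn _))))
    ((continuousOn_const.mul ((hK.continuousOn_star _).sub (hK.continuousOn_star _))).sub
      (continuousOn_const.mul ((hK.continuousOn_star _).sub (hK.continuousOn_star _))))
    (continuousOn_const.mul ((hK.continuousOn _).sub (hK.continuousOn _))) ?_ ?_ ?_
  · calc _ ≤ _ := le_add_of_nonneg_right (norm_nonneg _)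
      _ ≤ _ := key
      _ ≤ δ * r * Real.exp (‖w‖ * r + ∫ x in (0 : ℝ)..r, ‖a x‖) := by
        gcongr
        · exact hs.2
        · exact hs.2
        · exact hK.integral_norm_coeff_mono hs
      _ = _ := by ring
  · intro x hx
    simpa using hδ x ⟨hx.1, hx.2.trans hs.2⟩
  · intro x hx
    have d := hK.intervalIntegrable_deriv hx.1
    simp only [hK.eq_integral _ hx.1, add_sub_add_left_eq_sub]
    rw [← intervalIntegral.integral_sub (d z₁) (d w), ← intervalIntegral.integral_sub (d z₂) (d w),
      ← intervalIntegral.integral_const_mul, ← intervalIntegral.integral_const_mul,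
      ← intervalIntegral.integral_sub (((d z₁).sub (d w)).const_mul _)
        (((d z₂).sub (d w)).const_mul _)]
    refine intervalIntegral.integral_congr fun y _ ↦ ?_
    field_simp
    ring
  · intro x hx
    have d := hK.intervalIntegrable_neg_mul hx.1
    simp only [hK.star_eq_integral _ hx.1, add_sub_add_left_eq_sub]
    rw [← intervalIntegral.integral_sub (d z₁) (d w), ← intervalIntegral.integral_sub (d z₂) (d w),
      ← intervalIntegral.integral_const_mul, ← intervalIntegral.integral_const_mul,
      ← intervalIntegral.integral_sub (((d z₁).sub (d w)).const_mul _)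
        (((d z₂).sub (d w)).const_mul _), ← intervalIntegral.integral_neg]
    refine intervalIntegral.integral_congr fun y _ ↦ ?_
    ring

/-- The kernel `K_r(0, ·)` is entire. -/
theorem differentiable_kreinK (hK : IsKreinSystem a P Ps) (hr : 0 ≤ r) :
    Differentiable ℂ (kreinK P r 0) := by
  intro w
  obtain ⟨M, hM0, hM⟩ := hK.exists_norm_le hr w
  obtain ⟨N, hN0, hN⟩ := hK.exists_norm_le hr 0
  set A := ∫ x in (0 : ℝ)..r, ‖a x‖
  set L := M * r * Real.exp ((‖w‖ + 1) * r + A)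
  set C := r * Real.exp (‖w‖ * r + A)
  have hL (z : ℂ) (hz : ‖z - w‖ < 1) (s) (hs : s ∈ Set.Icc 0 r) :
      ‖P s z - P s w‖ ≤ ‖z - w‖ * L := by
    refine (hK.norm_eval_sub_le hM z hs).trans ?_
    have hzw : ‖z‖ ≤ ‖w‖ + 1 := by
      have := norm_le_norm_add_norm_sub' z w
      linarith
    unfold L
    gcongr
  have hslope (z₁ z₂ : ℂ) (h₁ : z₁ ≠ w) (h₂ : z₂ ≠ w) (h₁' : ‖z₁ - w‖ < 1) (h₂' : ‖z₂ - w‖ < 1) :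
      dist (slope (kreinK P r 0) w z₁) (slope (kreinK P r 0) w z₂) ≤
        N * ((‖z₁ - w‖ + ‖z₂ - w‖) * L * C) * r := by
    have hi := hK.intervalIntegrable_kernel hr 0
    have e : slope (kreinK P r 0) w z₁ - slope (kreinK P r 0) w z₂ =
        ∫ s in (0 : ℝ)..r, (starRingEnd ℂ) (P s 0) *
          ((z₁ - w)⁻¹ * (P s z₁ - P s w) - (z₂ - w)⁻¹ * (P s z₂ - P s w)) := by
      simp only [slope_def_field, kreinK, div_eq_inv_mul]
      rw [← intervalIntegral.integral_sub (hi z₁) (hi w),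
        ← intervalIntegral.integral_sub (hi z₂) (hi w),
        ← intervalIntegral.integral_const_mul, ← intervalIntegral.integral_const_mul,
        ← intervalIntegral.integral_sub (((hi z₁).sub (hi w)).const_mul _)
          (((hi z₂).sub (hi w)).const_mul _)]
      refine intervalIntegral.integral_congr fun y _ ↦ ?_
      ring
    rw [dist_eq_norm, e]
    refine (intervalIntegral.norm_integral_le_of_norm_le_const
      (C := N * ((‖z₁ - w‖ + ‖z₂ - w‖) * L * C)) fun s hs ↦ ?_).trans
      (by rw [sub_zero, abs_of_nonneg hr])
    rw [Set.uIoc_of_le hr] at hs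
    have hs' : s ∈ Set.Icc 0 r := ⟨hs.1.le, hs.2⟩
    rw [norm_mul, RCLike.norm_conj]
    gcongr
    · exact hN s hs'
    · refine hK.norm_slope_sub_slope_le h₁ h₂ (fun x hx ↦ ?_) hs'
      have b1 := hL z₁ h₁' x hx
      have b2 := hL z₂ h₂' x hx
      have b3 := norm_sub_le_norm_sub_add_norm_sub (P x z₁) (P x w) (P x z₂)
      rw [norm_sub_rev (P x w)] at b3
      linarith
  have hc : Cauchy (map (slope (kreinK P r 0) w) (nhdsWithin w {w}ᶜ)) := by
    rw [cauchy_map_iff', tendsto_uniformity_iff_dist_tendsto_zero]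
    have hmem : ∀ᶠ z in nhdsWithin w {w}ᶜ, z ≠ w ∧ ‖z - w‖ < 1 := by
      refine eventually_mem_nhdsWithin.and (nhdsWithin_le_nhds ?_)
      filter_upwards [Metric.ball_mem_nhds w one_pos] with z hz
      rwa [Metric.mem_ball, dist_eq_norm] at hz
    refine squeeze_zero' (Eventually.of_forall fun _ ↦ dist_nonneg)
      (g := fun p ↦ N * ((‖p.1 - w‖ + ‖p.2 - w‖) * L * C) * r) ?_ ?_
    · filter_upwards [hmem.prod_mk hmem] with p hp
      exact hslope p.1 p.2 hp.1.1 hp.2.1 hp.1.2 hp.2.2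
    · have : Tendsto (fun p : ℂ × ℂ ↦ N * ((‖p.1 - w‖ + ‖p.2 - w‖) * L * C) * r)
          (nhds (w, w)) (nhds 0) := by
        refine Continuous.tendsto' (by fun_prop) _ _ (by simp)
      rw [nhds_prod_eq] at this
      exact this.mono_left (prod_mono nhdsWithin_le_nhds nhdsWithin_le_nhds)
  obtain ⟨d, hd⟩ := cauchy_map_iff_exists_tendsto.1 hc
  exact (hasDerivAt_iff_tendsto_slope.2 hd).differentiableAt

theorem norm_le_norm_star (hK : IsKreinSystem a P Ps) (hr : 0 ≤ r) {z : ℂ} (hz : 0 ≤ z.im) :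
    ‖P r z‖ ≤ ‖Ps r z‖ := by
  have h := hK.sq_norm_star_sub_sq_norm hr z
  have h2 : 0 ≤ ∫ s in (0 : ℝ)..r, ‖P s z‖ ^ 2 :=
    intervalIntegral.integral_nonneg hr fun _ _ ↦ by positivity
  refine le_of_sq_le_sq ?_ (norm_nonneg _)
  have := mul_nonneg (mul_nonneg zero_le_two hz) h2
  linarith

theorem norm_star_le (hK : IsKreinSystem a P Ps) (hr : 0 ≤ r) {z : ℂ} (hz : 0 ≤ z.im) :
    ‖Ps r z‖ ≤ Real.exp (∫ x in (0 : ℝ)..r, ‖a x‖) := by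
  have h := le_mul_exp_integral_of_le_add_integral (u := fun s ↦ ‖Ps s z‖)
    (κ := fun x ↦ ‖a x‖) (δ := 1) hr (hK.intervalIntegrable hr).norm (fun _ ↦ norm_nonneg _)
    (hK.continuousOn_star z).norm ?_
  · simpa using h
  intro s hs
  rw [hK.star_eq_integral z hs.1]
  refine (norm_add_le _ _).trans ?_
  rw [norm_one]
  gcongr
  refine intervalIntegral.norm_integral_le_of_norm_le hs.1 (ae_of_all _ fun x hx ↦ ?_) ?_
  · rw [norm_neg, norm_mul]
    gcongr
    exact hK.norm_le_norm_star hx.1.le hz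
  · refine (hK.intervalIntegrable hs.1).norm.mul_continuousOn ?_
    rw [Set.uIcc_of_le hs.1]
    exact (hK.continuousOn_star z).norm

theorem norm_le_of_im_nonneg (hK : IsKreinSystem a P Ps) {z : ℂ} (hz : 0 ≤ z.im) {s : ℝ}
    (hs : s ∈ Set.Icc 0 r) :
    ‖P s z‖ ≤ Real.exp (∫ x in (0 : ℝ)..r, ‖a x‖) :=
  (hK.norm_le_norm_star hs.1 hz).trans <| (hK.norm_star_le hs.1 hz).trans <|
    Real.exp_le_exp.2 (hK.integral_norm_coeff_mono hs)

theorem norm_kreinK_le_of_norm_le (hr : 0 ≤ r) {w z : ℂ} {M N : ℝ}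
    (hM : ∀ s ∈ Set.Icc 0 r, ‖P s w‖ ≤ M) (hN : ∀ s ∈ Set.Icc 0 r, ‖P s z‖ ≤ N) :
    ‖kreinK P r w z‖ ≤ M * N * r := by
  have h := intervalIntegral.norm_integral_le_of_norm_le_const (a := 0) (b := r) (C := M * N)
    (f := fun s ↦ (starRingEnd ℂ) (P s w) * P s z) fun s hs ↦ by
      rw [Set.uIoc_of_le hr] at hs
      have hs' : s ∈ Set.Icc 0 r := ⟨hs.1.le, hs.2⟩
      rw [norm_mul, RCLike.norm_conj]
      exact mul_le_mul (hM s hs') (hN s hs') (norm_nonneg _) ((norm_nonneg _).trans (hM s hs'))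
  rwa [sub_zero, abs_of_nonneg hr] at h

theorem exists_norm_kreinK_le (hK : IsKreinSystem a P Ps) (hr : 0 ≤ r) :
    ∃ B, ∀ z, 0 ≤ z.im → ‖kreinK P r 0 z‖ ≤ B :=
  ⟨_, fun _ hz ↦ norm_kreinK_le_of_norm_le hr (fun _ hs ↦ hK.norm_le_of_im_nonneg (by simp) hs)
    fun _ hs ↦ hK.norm_le_of_im_nonneg hz hs⟩

theorem exists_norm_kreinK_le_exp (hK : IsKreinSystem a P Ps) (hr : 0 ≤ r) :
    ∃ B, 0 ≤ B ∧ ∀ z, ‖kreinK P r 0 z‖ ≤ B * Real.exp ((r + 1) * ‖z‖) := by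
  obtain ⟨M, hM0, hM⟩ := hK.exists_norm_le hr 0
  set A := ∫ x in (0 : ℝ)..r, ‖a x‖
  refine ⟨M * (M + M * r * Real.exp A) * r, by positivity, fun z ↦ ?_⟩
  have hN : ∀ s ∈ Set.Icc 0 r,
      ‖P s z‖ ≤ (M + M * r * Real.exp A) * Real.exp ((r + 1) * ‖z‖) := by
    intro s hs
    have h1 := hK.norm_eval_sub_le hM z hs
    rw [sub_zero, Real.exp_add] at h1
    have h2 := norm_le_norm_add_norm_sub' (P s z) (P s 0)
    have h3 := hM s hs
    have h4 : ‖z‖ ≤ Real.exp ‖z‖ := by linarith [Real.add_one_le_exp ‖z‖]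
    have h5 : Real.exp ((r + 1) * ‖z‖) = Real.exp ‖z‖ * Real.exp (‖z‖ * r) := by
      rw [← Real.exp_add]; ring_nf
    have h6 : 1 ≤ Real.exp ((r + 1) * ‖z‖) := Real.one_le_exp (by positivity)
    calc ‖P s z‖ ≤ M * 1 + M * r * Real.exp A * (‖z‖ * Real.exp (‖z‖ * r)) := by linarith
      _ ≤ M * Real.exp ((r + 1) * ‖z‖) +
          M * r * Real.exp A * (Real.exp ‖z‖ * Real.exp (‖z‖ * r)) := by gcongr
      _ = _ := by rw [h5]; ring
  refine (norm_kreinK_le_of_norm_le hr hM hN).trans (le_of_eq (by ring))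

theorem norm_sub_one_le (hK : IsKreinSystem a P Ps) {z : ℂ} (hz : 0 ≤ z.im) {s : ℝ}
    (hs : s ∈ Set.Icc 0 r) :
    ‖P s z - 1‖ ≤ Real.exp (∫ x in (0 : ℝ)..r, ‖a x‖) * (‖z‖ * s + ∫ x in (0 : ℝ)..s, ‖a x‖) := by
  set C := Real.exp (∫ x in (0 : ℝ)..r, ‖a x‖)
  have ha := (hK.intervalIntegrable hs.1).norm
  have hS : ∀ x ∈ Set.Icc 0 r, ‖Ps x z‖ ≤ C := fun x hx ↦
    (hK.norm_star_le hx.1 hz).trans (Real.exp_le_exp.2 (hK.integral_norm_coeff_mono hx))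
  have e : C * (‖z‖ * s + ∫ x in (0 : ℝ)..s, ‖a x‖) = ∫ x in (0 : ℝ)..s, C * (‖z‖ + ‖a x‖) := by
    rw [intervalIntegral.integral_const_mul, intervalIntegral.integral_add
      intervalIntegrable_const ha]
    simp [mul_comm]
  rw [e, hK.eq_integral z hs.1, add_sub_cancel_left]
  refine intervalIntegral.norm_integral_le_of_norm_le hs.1 (ae_of_all _ fun x hx ↦ ?_)
    ((intervalIntegrable_const.add ha).const_mul _)
  have hx' : x ∈ Set.Icc 0 r := ⟨hx.1.le, hx.2.trans hs.2⟩
  refine (norm_sub_le _ _).trans ?_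
  simp only [norm_mul, Complex.norm_I, one_mul, RCLike.norm_conj]
  have h1 := mul_le_mul_of_nonneg_left (hK.norm_le_of_im_nonneg hz hx') (norm_nonneg z)
  have h2 := mul_le_mul_of_nonneg_left (hS x hx') (norm_nonneg (a x))
  linarith

theorem exists_le_integral_sq_norm (hK : IsKreinSystem a P Ps) (hr : 0 < r) {η : ℝ} (hη : 0 < η) :
    ∃ c, 0 < c ∧ ∀ z : ℂ, η ≤ z.im → c ≤ ‖z‖ * ∫ s in (0 : ℝ)..r, ‖P s z‖ ^ 2 := by
  set C := Real.exp (∫ x in (0 : ℝ)..r, ‖a x‖) with hC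
  have hC0 : 0 < C := Real.exp_pos _
  have hcont : ContinuousOn (fun s ↦ ∫ x in (0 : ℝ)..s, ‖a x‖) (Set.uIcc 0 r) :=
    (hK.intervalIntegrable hr.le).norm.absolutelyContinuousOnInterval_integral.continuousOn
  rw [Set.uIcc_of_le hr.le] at hcont
  obtain ⟨δ, hδ, hδ'⟩ := Metric.continuousOn_iff.1 hcont 0 ⟨le_rfl, hr.le⟩ (1 / (4 * C))
    (by positivity)
  set s₀ := min (δ / 2) r
  have hs₀ : 0 < s₀ := lt_min (by positivity) hr
  set c := min (s₀ * η) (1 / (4 * C))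
  have hc : 0 < c := lt_min (by positivity) (by positivity)
  refine ⟨c / 4, by positivity, fun z hz ↦ ?_⟩
  have hzn : η ≤ ‖z‖ := hz.trans ((le_abs_self _).trans (Complex.abs_im_le_norm z))
  have hz0 : 0 < ‖z‖ := hη.trans_le hzn
  have hs1 : c / ‖z‖ ≤ s₀ := by
    rw [div_le_iff₀ hz0]
    exact (min_le_left _ _).trans (by gcongr)
  have hs1' : 0 < c / ‖z‖ := by positivity
  have hs1r : c / ‖z‖ ≤ r := hs1.trans (min_le_right _ _)
  have hP : ∀ s ∈ Set.Icc 0 (c / ‖z‖), 1 / 4 ≤ ‖P s z‖ ^ 2 := by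
    intro s hs
    have hsr : s ∈ Set.Icc 0 r := ⟨hs.1, hs.2.trans hs1r⟩
    have h1 := hK.norm_sub_one_le (hη.le.trans hz) hsr
    have h2 := hδ' s hsr (by
      rw [Real.dist_eq, sub_zero, abs_of_nonneg hs.1]
      have : s₀ ≤ δ / 2 := min_le_left _ _
      linarith [hs.2])
    rw [intervalIntegral.integral_same, Real.dist_eq, sub_zero] at h2
    have h3 := (le_abs_self _).trans h2.le
    have h4 : ‖z‖ * s ≤ 1 / (4 * C) := by
      have := (le_div_iff₀' hz0).1 hs.2
      exact this.trans (min_le_right _ _)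
    have h5 : ‖P s z - 1‖ ≤ 1 / 2 := by
      calc _ ≤ _ := h1
        _ ≤ C * (1 / (4 * C) + 1 / (4 * C)) := by gcongr
        _ = 1 / 2 := by field_simp; norm_num
    have h6 := norm_sub_norm_le 1 (P s z)
    rw [norm_one, norm_sub_rev] at h6
    nlinarith
  have hi : IntervalIntegrable (fun s ↦ ‖P s z‖ ^ 2) volume 0 r := by
    refine ContinuousOn.intervalIntegrable ?_
    rw [Set.uIcc_of_le hr.le]
    exact (hK.continuousOn z).norm.pow 2
  have hlow : c / ‖z‖ * (1 / 4) ≤ ∫ s in (0 : ℝ)..r, ‖P s z‖ ^ 2 := by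
    calc c / ‖z‖ * (1 / 4) = ∫ s in (0 : ℝ)..(c / ‖z‖), (1 / 4 : ℝ) := by simp
      _ ≤ ∫ s in (0 : ℝ)..(c / ‖z‖), ‖P s z‖ ^ 2 := by
        refine intervalIntegral.integral_mono_on hs1'.le intervalIntegrable_const
          (hi.mono_set ?_) hP
        rw [Set.uIcc_of_le hs1'.le, Set.uIcc_of_le hr.le]
        exact Set.Icc_subset_Icc_right hs1r
      _ ≤ _ := intervalIntegral.integral_mono_interval le_rfl hs1'.le hs1r
        (ae_of_all _ fun x ↦ by positivity) hi
  calc c / 4 = ‖z‖ * (c / ‖z‖ * (1 / 4)) := by field_simp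
    _ ≤ _ := by gcongr

theorem mul_norm_kreinK_zero_ge (hK : IsKreinSystem a P Ps) (hr : 0 ≤ r) {z : ℂ}
    (hz : 0 ≤ z.im) :
    ‖P r 0‖ * (z.im * ∫ s in (0 : ℝ)..r, ‖P s z‖ ^ 2) ≤
      Real.exp (∫ x in (0 : ℝ)..r, ‖a x‖) * (‖z‖ * ‖kreinK P r 0 z‖) := by
  have h0 := hK.sq_norm_star_sub_sq_norm hr 0
  rw [Complex.zero_im, mul_zero, zero_mul, sub_eq_zero] at h0
  have h0' : ‖Ps r 0‖ = ‖P r 0‖ := (sq_eq_sq₀ (norm_nonneg _) (norm_nonneg _)).1 h0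
  have hcd := congrArg norm (hK.christoffel_darboux hr 0 z)
  simp only [map_zero, sub_zero, norm_mul, Complex.norm_I, one_mul] at hcd
  have h1 := norm_sub_norm_le (Ps r z * (starRingEnd ℂ) (Ps r 0)) (P r z * (starRingEnd ℂ) (P r 0))
  rw [norm_sub_rev, hcd] at h1
  simp only [norm_mul, RCLike.norm_conj, h0'] at h1
  have h2 := hK.sq_norm_star_sub_sq_norm hr z
  have h3 := hK.norm_le_norm_star hr hz
  have h4 := hK.norm_star_le hr hz
  set C := Real.exp (∫ x in (0 : ℝ)..r, ‖a x‖)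
  calc ‖P r 0‖ * (z.im * ∫ s in (0 : ℝ)..r, ‖P s z‖ ^ 2)
      = ‖P r 0‖ * ((‖Ps r z‖ - ‖P r z‖) * ((‖Ps r z‖ + ‖P r z‖) / 2)) := by
        linear_combination (-‖P r 0‖ / 2) * h2
    _ ≤ ‖P r 0‖ * ((‖Ps r z‖ - ‖P r z‖) * C) := by
        gcongr
        · linarith
    _ = C * (‖Ps r z‖ * ‖P r 0‖ - ‖P r z‖ * ‖P r 0‖) := by ring
    _ ≤ _ := by gcongr

/-- Away from the real line `K_r(0, ·)` decays at most quadratically in the upper half-plane. -/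
theorem exists_le_sq_norm_mul_kreinK (hK : IsKreinSystem a P Ps) (hr : 0 < r) (h0 : P r 0 ≠ 0)
    {η : ℝ} (hη : 0 < η) :
    ∃ c, 0 < c ∧ ∀ z : ℂ, η ≤ z.im → c ≤ ‖z‖ ^ 2 * ‖kreinK P r 0 z‖ := by
  obtain ⟨c, hc, h⟩ := hK.exists_le_integral_sq_norm hr hη
  set C := Real.exp (∫ x in (0 : ℝ)..r, ‖a x‖)
  have hC0 : 0 < C := Real.exp_pos _
  have hp : 0 < ‖P r 0‖ := norm_pos_iff.2 h0
  refine ⟨‖P r 0‖ * η * c / C, by positivity, fun z hz ↦ ?_⟩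
  have h1 := hK.mul_norm_kreinK_zero_ge hr.le (hη.le.trans hz)
  rw [div_le_iff₀ hC0]
  calc ‖P r 0‖ * η * c
      ≤ ‖P r 0‖ * z.im * (‖z‖ * ∫ s in (0 : ℝ)..r, ‖P s z‖ ^ 2) := by
        have := hη.le.trans hz
        gcongr
        exact h z hz
    _ = ‖z‖ * (‖P r 0‖ * (z.im * ∫ s in (0 : ℝ)..r, ‖P s z‖ ^ 2)) := by ring
    _ ≤ ‖z‖ * (C * (‖z‖ * ‖kreinK P r 0 z‖)) := by gcongr
    _ = _ := by ring

theorem kreinK_eq_exp_mul_conj (hK : IsKreinSystem a P Ps) (hr : 0 ≤ r) {z : ℂ} (hz : z ≠ 0) :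
    kreinK P r 0 z = Complex.exp (Complex.I * z * r) *
      (starRingEnd ℂ) (kreinK P r 0 ((starRingEnd ℂ) z)) := by
  have h1 := hK.christoffel_darboux hr 0 z
  have h2 := congrArg (starRingEnd ℂ) (hK.christoffel_darboux hr 0 ((starRingEnd ℂ) z))
  obtain ⟨r1, r2⟩ := hK.reflection hr z
  have r3 := (hK.reflection hr 0).2
  have r4 := congrArg (starRingEnd ℂ) r3
  simp only [map_zero, map_mul, map_sub, Complex.conj_conj, Complex.conj_I, sub_zero, mul_zero,
    zero_mul, Complex.exp_zero, one_mul] at h1 h2 r3 r4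
  rw [r1, r2, r4] at h1
  rw [r3] at h2
  refine mul_left_cancel₀ (mul_ne_zero Complex.I_ne_zero hz) ?_
  linear_combination -h1 - Complex.exp (Complex.I * z * r) * h2

theorem norm_kreinK_of_im_neg (hK : IsKreinSystem a P Ps) (hr : 0 ≤ r) {z : ℂ} (hz : z.im < 0) :
    ‖kreinK P r 0 z‖ = Real.exp (-z.im * r) * ‖kreinK P r 0 ((starRingEnd ℂ) z)‖ := by
  have hz0 : z ≠ 0 := by rintro rfl; simp at hz
  conv_lhs => rw [hK.kreinK_eq_exp_mul_conj hr hz0]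
  rw [norm_mul, RCLike.norm_conj, Complex.norm_exp]
  congr 2
  simp

end IsKreinSystem

/-- A Phragmén–Lindelöf principle on the right half-plane: polynomial growth along the positive
real axis is allowed. -/
theorem norm_le_of_norm_le_sq_on_real {f : ℂ → ℂ} {A B R C D : ℝ} (hR : 0 ≤ R) (hD : 0 ≤ D)
    (hd : DiffContOnCl ℂ f {w | 0 < w.re})
    (hexp : ∀ w : ℂ, 0 < w.re → ‖f w‖ ≤ A * Real.exp (B * ‖w‖))
    (hre : ∀ᶠ x : ℝ in atTop, ‖f x‖ ≤ D * (x + R) ^ 2)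
    (him : ∀ x : ℝ, ‖f (x * Complex.I)‖ ≤ C) {z : ℂ} (hz : 0 ≤ z.re) : ‖f z‖ ≤ C := by
  have hA : 0 ≤ A :=
    nonneg_of_mul_nonneg_left ((norm_nonneg _).trans (hexp 1 (by simp))) (Real.exp_pos _)
  have hnorm (ε : ℝ) (w : ℂ) : ‖Complex.exp (-ε * w)‖ = Real.exp (-ε * w.re) := by
    rw [Complex.norm_exp]; simp
  have key : ∀ ε : ℝ, 0 < ε → ‖Complex.exp (-ε * z) * f z‖ ≤ C := by
    intro ε hε
    refine PhragmenLindelof.right_half_plane_of_bounded_on_real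
      (f := fun w ↦ Complex.exp (-ε * w) * f w) ?_ ⟨1, by norm_num, B, ?_⟩ ?_ ?_ hz
    · exact (by fun_prop : Differentiable ℂ fun w : ℂ ↦ Complex.exp (-ε * w)).diffContOnCl.smul hd
    · refine Asymptotics.IsBigO.of_bound A ?_
      refine mem_inf_of_right fun w hw ↦ ?_
      have hw' : 0 < w.re := hw
      simp only [Set.mem_ofPred_eq, norm_mul, hnorm, Real.rpow_one, Real.norm_eq_abs, Real.abs_exp]
      have h1 : Real.exp (-ε * w.re) ≤ 1 := Real.exp_le_one_iff.2 (by nlinarith)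
      calc _ ≤ 1 * ‖f w‖ := by gcongr
        _ ≤ _ := by rw [one_mul]; exact hexp w hw'
    · refine isBoundedUnder_of_eventually_le (a := D * (2 / ε ^ 2 * Real.exp (ε * R))) ?_
      filter_upwards [hre, eventually_ge_atTop 0] with x hx hx0
      rw [norm_mul, hnorm, Complex.ofReal_re]
      have h1 := Real.quadratic_le_exp_of_nonneg (x := ε * (x + R)) (by positivity)
      have h2 : (x + R) ^ 2 ≤ 2 / ε ^ 2 * Real.exp (ε * (x + R)) := by
        rw [div_mul_eq_mul_div, le_div_iff₀ (by positivity)]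
        have : 0 ≤ ε * (x + R) := by positivity
        nlinarith
      calc Real.exp (-ε * x) * ‖f x‖
          ≤ Real.exp (-ε * x) * (D * (2 / ε ^ 2 * Real.exp (ε * (x + R)))) := by
            gcongr
            exact hx.trans (by gcongr)
        _ = D * (2 / ε ^ 2 * (Real.exp (-ε * x) * Real.exp (ε * (x + R)))) := by ring
        _ = _ := by rw [← Real.exp_add]; ring_nf
    · intro x
      rw [norm_mul, hnorm]
      simpa using him x
  have hlim : Tendsto (fun ε : ℝ ↦ ‖Complex.exp (-ε * z) * f z‖) (nhdsWithin 0 (Set.Ioi 0))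
      (nhds ‖f z‖) := by
    refine Tendsto.mono_left ?_ nhdsWithin_le_nhds
    exact Continuous.tendsto' (by fun_prop) _ _ (by simp)
  exact le_of_tendsto hlim (eventually_mem_nhdsWithin.mono key)

theorem IsKreinSystem.norm_kreinK_le {a : ℝ → ℂ} {P Ps : ℝ → ℂ → ℂ} (hK : IsKreinSystem a P Ps)
    {r : ℝ} (hr : 0 < r) (t : ℝ) {γ : ℝ} (hγ : 0 < γ) :
    ‖kreinK P r 0 t‖ ≤ Real.exp (γ * r / 2) * ‖kreinK P r 0 (t + γ * Complex.I)‖ := by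
  have hdiff := hK.differentiable_kreinK hr.le
  by_cases h0 : P r 0 = 0
  · have hz : kreinK P r 0 = 0 := by
      refine Continuous.ext_on (dense_compl_singleton (0 : ℂ)) hdiff.continuous
        continuous_const fun z hz ↦ ?_
      have h1 := hK.christoffel_darboux hr.le 0 z
      have h2 := (hK.reflection hr.le 0).2
      rw [map_zero, h0, map_zero, mul_zero] at h2
      rw [h0, h2, map_zero, mul_zero, mul_zero, sub_zero, sub_zero, eq_comm] at h1
      simpa [show z ≠ 0 from hz] using h1
    simp [hz]
  obtain ⟨c, hc, hlow⟩ := hK.exists_le_sq_norm_mul_kreinK hr h0 (half_pos hγ)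
  obtain ⟨B, hB0, hB⟩ := hK.exists_norm_kreinK_le_exp hr.le
  obtain ⟨M, hM⟩ := hK.exists_norm_kreinK_le hr.le
  have hM0 : 0 ≤ M := (norm_nonneg _).trans (hM 0 le_rfl)
  set Z : ℂ → ℂ := fun w ↦ t - γ / 2 * Complex.I + Complex.I * w with hZ
  set R := |t| + 2 * γ with hR
  have hR0 : 0 ≤ R := by positivity
  have hZim (w : ℂ) : (Z w).im = w.re - γ / 2 := by simp [hZ]; ring
  have hZim' (w : ℂ) : (Z w + γ * Complex.I).im = w.re + γ / 2 := by
    rw [Complex.add_im, hZim]; simp; ring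
  have hZn (w : ℂ) : ‖Z w‖ ≤ ‖w‖ + (|t| + γ) := by
    refine (norm_add_le _ _).trans ?_
    have h1 := norm_sub_le (t : ℂ) (γ / 2 * Complex.I)
    have h2 : ‖(γ / 2 * Complex.I : ℂ)‖ = γ / 2 := by
      simp [abs_of_pos hγ]
    rw [h2, Complex.norm_real, Real.norm_eq_abs] at h1
    simp only [norm_mul, Complex.norm_I, one_mul]
    linarith
  have hZn' (w : ℂ) : ‖Z w + γ * Complex.I‖ ≤ ‖w‖ + R := by
    refine (norm_add_le _ _).trans ?_
    have h1 := hZn w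
    have h2 : ‖(γ * Complex.I : ℂ)‖ = γ := by simp [abs_of_pos hγ]
    rw [h2]
    linarith
  have hlow' (w : ℂ) (hw : 0 ≤ w.re) :
      c ≤ (‖w‖ + R) ^ 2 * ‖kreinK P r 0 (Z w + γ * Complex.I)‖ := by
    refine (hlow _ (by rw [hZim']; linarith)).trans ?_
    gcongr
    exact hZn' w
  have hne (w : ℂ) (hw : 0 ≤ w.re) : kreinK P r 0 (Z w + γ * Complex.I) ≠ 0 := by
    intro h
    have := hlow' w hw
    rw [h, norm_zero, mul_zero] at this
    linarith
  have hinv (w : ℂ) (hw : 0 ≤ w.re) :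
      ‖kreinK P r 0 (Z w + γ * Complex.I)‖⁻¹ ≤ (‖w‖ + R) ^ 2 / c := by
    rw [inv_le_iff_one_le_mul₀ (norm_pos_iff.2 (hne w hw)), div_mul_eq_mul_div, le_div_iff₀ hc,
      one_mul]
    exact hlow' w hw
  have hZd : Differentiable ℂ Z := by fun_prop
  have main := norm_le_of_norm_le_sq_on_real
    (f := fun w ↦ kreinK P r 0 (Z w) / kreinK P r 0 (Z w + γ * Complex.I))
    (A := B * Real.exp ((r + 1) * R) * (2 * Real.exp R / c)) (B := r + 2) (R := R)
    (C := Real.exp (γ * r / 2)) (D := M / c) hR0 (by positivity) ?_ ?_ ?_ ?_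
    (z := (γ / 2 : ℝ)) (by rw [Complex.ofReal_re]; positivity)
  · have e : Z (γ / 2 : ℝ) = t := by simp only [hZ]; push_cast; ring
    have hpos := norm_pos_iff.2 (hne (γ / 2 : ℝ) (by rw [Complex.ofReal_re]; positivity))
    rw [norm_div, div_le_iff₀ hpos, e] at main
    exact main
  · refine DifferentiableOn.diffContOnCl fun w hw ↦ ?_
    rw [Complex.closure_setOfPred_lt_re] at hw
    refine DifferentiableAt.differentiableWithinAt ?_
    exact ((hdiff _).comp w (hZd w)).div
      ((hdiff _).comp w ((hZd w).add_const _)) (hne w hw)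
  · intro w hw
    rw [norm_div, div_eq_mul_inv]
    have h1 : (‖w‖ + R) ^ 2 ≤ 2 * Real.exp R * Real.exp ‖w‖ := by
      have h := Real.quadratic_le_exp_of_nonneg (x := ‖w‖ + R) (by positivity)
      have h' : 0 ≤ ‖w‖ + R := by positivity
      rw [Real.exp_add] at h
      linarith
    calc _ ≤ B * Real.exp ((r + 1) * (‖w‖ + R)) * ((‖w‖ + R) ^ 2 / c) := by
          gcongr
          · refine (hB _).trans ?_
            gcongr
            exact (hZn w).trans (by linarith)
          · exact hinv w hw.le
      _ ≤ B * Real.exp ((r + 1) * (‖w‖ + R)) * (2 * Real.exp R * Real.exp ‖w‖ / c) := by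
          gcongr
      _ = _ := by
          have e1 : Real.exp ((r + 1) * (‖w‖ + R)) =
              Real.exp ((r + 1) * ‖w‖) * Real.exp ((r + 1) * R) := by
            rw [← Real.exp_add, mul_add]
          have e2 : Real.exp ((r + 2) * ‖w‖) = Real.exp ((r + 1) * ‖w‖) * Real.exp ‖w‖ := by
            rw [← Real.exp_add]
            congr 1
            ring
          rw [e1, e2]
          ring
  · filter_upwards [eventually_ge_atTop (γ / 2)] with x hx
    have hx0 : 0 ≤ x := by linarith
    rw [norm_div, div_eq_mul_inv]
    have h1 := hinv x (by simpa using hx0)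
    rw [Complex.norm_real, Real.norm_eq_abs, abs_of_nonneg hx0] at h1
    calc _ ≤ M * ((x + R) ^ 2 / c) := by
          gcongr
          exact hM _ (by rw [hZim, Complex.ofReal_re]; linarith)
      _ = _ := by ring
  · intro y
    have him : (Z (y * Complex.I)).im = -(γ / 2) := by rw [hZim]; simp
    have hconj : (starRingEnd ℂ) (Z (y * Complex.I)) = Z (y * Complex.I) + γ * Complex.I := by
      apply Complex.ext
      · simp
      · rw [Complex.conj_im, him, hZim']; simp
    have h := hK.norm_kreinK_of_im_neg hr.le (z := Z (y * Complex.I)) (by rw [him]; linarith)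
    rw [hconj, him] at h
    rw [norm_div, h, mul_div_assoc,
      div_self (norm_ne_zero_iff.2 (hne _ (by simp))), mul_one]
    exact Real.exp_le_exp.2 (le_of_eq (by ring))

/-- For the extremal function `f_r` of a Krein system,
`|f_r(t)| ≤ |f_r(t + iγ)| e^{γ r}` for all `t ∈ ℝ`, `γ > 0`. -/
theorem kreinf_bound
    (a : ℝ → ℂ) (P Ps : ℝ → ℂ → ℂ)
    (hK : IsKreinSystem a P Ps)
    (r : ℝ) (hr : 0 < r) :
    ∀ t : ℝ, ∀ γ : ℝ, 0 < γ →
      ‖kreinf P r (t : ℂ)‖ ≤ ‖kreinf P r ((t : ℂ) + γ * Complex.I)‖ * Real.exp (γ * r) := by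
  intro t γ hγ
  rw [kreinf, kreinf, norm_div, norm_div, div_mul_eq_mul_div]
  gcongr
  rw [mul_comm]
  refine (hK.norm_kreinK_le hr t hγ).trans ?_
  gcongr
  have := mul_pos hγ hr
  linarith
end
end
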